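/- arXiv:2211.08409 — 8 statements merged into one kernel-verified Lean document; each statement's English description precedes it below -/
import Mathlib

section
/- Let 0 ≤ a, b ≤ N be integers. The map sending a pair (M_A, M_B) to the triple (Λ₁, Λ₂, Λ₃) with Λ₁ = E(M_A) ∩ E(M_B), Λ₂ = E(M_A) ∩ Λ₁^⊥ (the orthogonal complement of Λ₁ inside E(M_A)), and Λ₃ = E(M_B) ∩ Λ₁^⊥, is a bijection from the set { (M_A, M_B) ∈ C_a × C_b : M_A M_B = M_B M_A } onto the set of triples (Λ₁, Λ₂, Λ₃) of pairwise orthogonal complex vector subspaces of ℂ^N satisfying dim Λ₂ = a − dim Λ₁ and dim Λ₃ = b − dim Λ₁. -/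
/-- The matrix `Φ_a = e^{aπi/N} · diag(−Id_a, Id_{N−a})`. -/
noncomputable def Phi (N a : ℕ) : Matrix (Fin N) (Fin N) ℂ :=
  Complex.exp (a * Real.pi * Complex.I / N) •
    Matrix.diagonal (fun i : Fin N => if (i : ℕ) < a then (-1 : ℂ) else 1)

/-- The conjugacy class of `Φ_a` in `SU(N)`. -/
noncomputable def conjClass (N a : ℕ) : Set (Matrix (Fin N) (Fin N) ℂ) :=
  {M | ∃ U ∈ Matrix.specialUnitaryGroup (Fin N) ℂ, M = U * Phi N a * U⁻¹}

/-- The eigenspace of `M` for the eigenvalue `−e^{aπi/N}`, as a subspace of `ℂ^N` with its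
standard Hermitian inner product. -/
noncomputable def eigSp (N a : ℕ) (M : Matrix (Fin N) (Fin N) ℂ) :
    Submodule ℂ (EuclideanSpace ℂ (Fin N)) :=
  Module.End.eigenspace (Matrix.toEuclideanLin M)
    (-(Complex.exp (a * Real.pi * Complex.I / N)))

/-- The matrix of the orthogonal projection of `ℂ^N` onto a subspace. -/
noncomputable def projMatrix {N : ℕ} (E : Submodule ℂ (EuclideanSpace ℂ (Fin N))) :
    Matrix (Fin N) (Fin N) ℂ :=
  (Matrix.toEuclideanCLM (n := Fin N) (𝕜 := ℂ)).symm E.starProjection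

/-- The matrix acting as `-e^{aπi/N}` on `E` and as `e^{aπi/N}` on `Eᗮ`. -/
noncomputable def reflMatrix {N : ℕ} (a : ℕ) (E : Submodule ℂ (EuclideanSpace ℂ (Fin N))) :
    Matrix (Fin N) (Fin N) ℂ :=
  Complex.exp (a * Real.pi * Complex.I / N) • (1 - (2 : ℂ) • projMatrix E)

/-- The orthogonal projection onto the first `a` coordinates. -/
noncomputable def coordProj (N a : ℕ) : Matrix (Fin N) (Fin N) ℂ :=
  Matrix.diagonal fun i : Fin N => if (i : ℕ) < a then (1 : ℂ) else 0

theorem toEuclideanCLM_projMatrix {N : ℕ} (E : Submodule ℂ (EuclideanSpace ℂ (Fin N))) :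
    Matrix.toEuclideanCLM (n := Fin N) (𝕜 := ℂ) (projMatrix E) = E.starProjection := by
  simp [projMatrix]

theorem Phi_eq (N a : ℕ) :
    Phi N a = Complex.exp (a * Real.pi * Complex.I / N) • (1 - (2 : ℂ) • coordProj N a) := by
  unfold Phi coordProj
  congr 1
  rw [← Matrix.diagonal_one, ← Matrix.diagonal_smul, Matrix.diagonal_sub]
  congr 1
  ext i
  by_cases h : (i : ℕ) < a <;> simp [h]
  norm_num

theorem rank_coordProj {N a : ℕ} (ha : a ≤ N) : (coordProj N a).rank = a := by
  rw [coordProj, Matrix.rank_diagonal]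
  simp only [ne_eq, ite_eq_right_iff, one_ne_zero, imp_false, not_not]
  rw [Fintype.card_subtype]
  simp [Fin.card_filter_val_lt, ha]

theorem isStarProjection_coordProj (N a : ℕ) : IsStarProjection (coordProj N a) := by
  constructor
  · simp [IsIdempotentElem, coordProj]
  · rw [isSelfAdjoint_iff, Matrix.star_eq_conjTranspose, coordProj,
      Matrix.diagonal_conjTranspose]
    congr 1
    ext i
    by_cases h : (i : ℕ) < a <;> simp [h]

theorem exists_eq_projMatrix_of_isStarProjection {N : ℕ} {Q : Matrix (Fin N) (Fin N) ℂ}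
    (hQ : IsStarProjection Q) :
    ∃ E : Submodule ℂ (EuclideanSpace ℂ (Fin N)),
      Module.finrank ℂ E = Q.rank ∧ Q = projMatrix E := by
  have h := hQ.map (Matrix.toEuclideanCLM (n := Fin N) (𝕜 := ℂ))
  obtain ⟨_, h⟩ := isStarProjection_iff_eq_starProjection_range.mp h
  refine ⟨_, ?_, (Matrix.toEuclideanCLM (n := Fin N) (𝕜 := ℂ)).injective
    (h.trans (toEuclideanCLM_projMatrix _).symm)⟩
  rw [Matrix.rank_eq_finrank_range_toLin Q (EuclideanSpace.basisFun (Fin N) ℂ).toBasis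
    (EuclideanSpace.basisFun (Fin N) ℂ).toBasis]
  rfl

/-- Any unitary matrix can be corrected by a phase on one column to have determinant one. -/
theorem exists_specialUnitary_mul_diagonal {N : ℕ} (hN : 0 < N) {U : Matrix (Fin N) (Fin N) ℂ}
    (hU : U ∈ Matrix.unitaryGroup (Fin N) ℂ) :
    ∃ d : Fin N → ℂ, U * Matrix.diagonal d ∈ Matrix.specialUnitaryGroup (Fin N) ℂ := by
  have hdet := Matrix.det_of_mem_unitary hU
  have h1 := (Unitary.mem_iff.mp hdet).1
  have h2 := (Unitary.mem_iff.mp hdet).2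
  refine ⟨fun i => if i = ⟨0, hN⟩ then star U.det else 1, ?_⟩
  rw [Matrix.mem_specialUnitaryGroup_iff]
  constructor
  · refine mul_mem hU ?_
    rw [Matrix.mem_unitaryGroup_iff, Matrix.star_eq_conjTranspose,
      Matrix.diagonal_conjTranspose, Matrix.diagonal_mul_diagonal, ← Matrix.diagonal_one]
    congr 1
    ext i
    by_cases h : i = ⟨0, hN⟩
    · simpa [h] using h1
    · simp [h]
  · rw [Matrix.det_mul, Matrix.det_diagonal, Finset.prod_ite_eq' Finset.univ]
    simpa using h2

theorem exists_unitary_projMatrix_mul {N a : ℕ} (ha : a ≤ N)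
    {E : Submodule ℂ (EuclideanSpace ℂ (Fin N))} (hE : Module.finrank ℂ E = a) :
    ∃ U ∈ Matrix.unitaryGroup (Fin N) ℂ, projMatrix E * U = U * coordProj N a := by
  subst hE
  let e := stdOrthonormalBasis ℂ E
  let v : Fin N → EuclideanSpace ℂ (Fin N) := fun i =>
    if h : (i : ℕ) < Module.finrank ℂ E then (e ⟨i, h⟩ : EuclideanSpace ℂ (Fin N)) else 0
  let s : Set (Fin N) := {i | (i : ℕ) < Module.finrank ℂ E}
  have hv : Orthonormal ℂ (s.domRestrict v) := by
    have he : Orthonormal ℂ (fun i => (e i : EuclideanSpace ℂ (Fin N))) :=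
      e.orthonormal.comp_linearIsometry E.subtypeₗᵢ
    have := he.comp (fun i : s => (⟨i.1, i.2⟩ : Fin (Module.finrank ℂ E)))
      (fun i j h => Subtype.ext (Fin.ext (by simpa using h)))
    convert this using 1
    ext1 i
    have hi : ((i : Fin N) : ℕ) < Module.finrank ℂ E := i.2
    simp [v, hi, Set.domRestrict_apply]
  obtain ⟨b, hb⟩ := hv.exists_orthonormalBasis_extension_of_card_eq (by simp)
  have hmem : ∀ j : Fin N, (j : ℕ) < Module.finrank ℂ E → b j ∈ E := fun j hj => by
    rw [hb j hj]
    simp [v, hj]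
  have hperp : ∀ j : Fin N, ¬ (j : ℕ) < Module.finrank ℂ E → b j ∈ Eᗮ := fun j hj => by
    rw [Submodule.mem_orthogonal]
    intro u hu
    have hu' : u = ∑ i, e.repr ⟨u, hu⟩ i • (e i : EuclideanSpace ℂ (Fin N)) := by
      have := congrArg Subtype.val (e.sum_repr ⟨u, hu⟩)
      simpa using this.symm
    rw [hu', sum_inner]
    refine Finset.sum_eq_zero fun i _ => ?_
    have hi : b (Fin.castLE ha i) = e i := by
      rw [hb _ (by simp [s])]
      simp [v]
    rw [inner_smul_left, ← hi, b.orthonormal.2, mul_zero]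
    rintro rfl
    exact hj (by simp)
  refine ⟨(EuclideanSpace.basisFun (Fin N) ℂ).toBasis.toMatrix b,
    OrthonormalBasis.toMatrix_orthonormalBasis_mem_unitary _ _, ?_⟩
  ext i j
  have hcol : (fun k => (EuclideanSpace.basisFun (Fin N) ℂ).toBasis.toMatrix b k j) =
      (b j).ofLp := by
    ext k
    simp [Module.Basis.toMatrix_apply]
  have hP : (projMatrix E).mulVec (b j).ofLp = (E.starProjection (b j)).ofLp := by
    rw [← toEuclideanCLM_projMatrix, Matrix.ofLp_toEuclideanCLM]
  have hl : (projMatrix E * (EuclideanSpace.basisFun (Fin N) ℂ).toBasis.toMatrix b) i j =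
      (E.starProjection (b j)).ofLp i := by
    rw [← hP, ← hcol]
    rfl
  rw [hl, coordProj, Matrix.mul_diagonal]
  by_cases hj : (j : ℕ) < Module.finrank ℂ E
  · rw [E.starProjection_eq_self_iff.mpr (hmem j hj)]
    simp [hj, Module.Basis.toMatrix_apply]
  · rw [E.starProjection_apply_eq_zero_iff.mpr (hperp j hj)]
    simp [hj]

theorem mem_conjClass_iff {N a : ℕ} (hN : 0 < N) (ha : a ≤ N) (M : Matrix (Fin N) (Fin N) ℂ) :
    M ∈ conjClass N a ↔ ∃ E : Submodule ℂ (EuclideanSpace ℂ (Fin N)),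
      Module.finrank ℂ E = a ∧ M = reflMatrix a E := by
  constructor
  · rintro ⟨U, hU, rfl⟩
    have hU' := (Matrix.mem_specialUnitaryGroup_iff.mp hU).1
    have hs : U * star U = 1 := Matrix.mem_unitaryGroup_iff.mp hU'
    have hs' : star U * U = 1 := Matrix.mem_unitaryGroup_iff'.mp hU'
    have hinv : U⁻¹ = star U := Matrix.inv_eq_right_inv hs
    have hdet : IsUnit U.det := by
      rw [(Matrix.mem_specialUnitaryGroup_iff.mp hU).2]
      exact isUnit_one
    have hQ : IsStarProjection (U * coordProj N a * star U) := by
      have hD := isStarProjection_coordProj N a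
      constructor
      · have := hD.isIdempotentElem.eq
        calc U * coordProj N a * star U * (U * coordProj N a * star U)
            = U * (coordProj N a * (star U * U) * coordProj N a) * star U := by
              simp only [mul_assoc]
          _ = U * coordProj N a * star U := by rw [hs', mul_one, this]
      · exact hD.isSelfAdjoint.conjugate U
    obtain ⟨E, hE, hQE⟩ := exists_eq_projMatrix_of_isStarProjection hQ
    refine ⟨E, ?_, ?_⟩
    · rw [hE, ← hinv, Matrix.rank_mul_eq_left_of_isUnit_det,
        Matrix.rank_mul_eq_right_of_isUnit_det _ _ hdet, rank_coordProj ha]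
      exact Matrix.isUnit_nonsing_inv_det _ hdet
    · rw [reflMatrix, ← hQE, hinv, Phi_eq]
      simp only [Matrix.mul_smul, Matrix.smul_mul, mul_sub, sub_mul, mul_one, hs]
  · rintro ⟨E, hE, rfl⟩
    obtain ⟨U, hU, hEU⟩ := exists_unitary_projMatrix_mul ha hE
    obtain ⟨d, hd⟩ := exists_specialUnitary_mul_diagonal hN hU
    refine ⟨_, hd, ?_⟩
    have hdet : IsUnit (U * Matrix.diagonal d).det := by
      rw [(Matrix.mem_specialUnitaryGroup_iff.mp hd).2]
      exact isUnit_one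
    have hcomm : projMatrix E * (U * Matrix.diagonal d) =
        U * Matrix.diagonal d * coordProj N a := by
      rw [← mul_assoc, hEU, mul_assoc, mul_assoc, coordProj, Matrix.diagonal_mul_diagonal,
        Matrix.diagonal_mul_diagonal]
      simp only [mul_comm]
    have : reflMatrix a E * (U * Matrix.diagonal d) = U * Matrix.diagonal d * Phi N a := by
      rw [Phi_eq, reflMatrix, Matrix.smul_mul, Matrix.mul_smul, sub_mul, mul_sub, one_mul,
        mul_one, Matrix.smul_mul, Matrix.mul_smul, hcomm]
    rw [← this, Matrix.mul_nonsing_inv_cancel_right _ _ hdet]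

theorem eigSp_reflMatrix {N : ℕ} (a : ℕ) (E : Submodule ℂ (EuclideanSpace ℂ (Fin N))) :
    eigSp N a (reflMatrix a E) = E := by
  ext v
  rw [eigSp, Module.End.mem_eigenspace_iff, ← E.starProjection_eq_self_iff]
  have hc := Complex.exp_ne_zero (a * Real.pi * Complex.I / N)
  have happ : Matrix.toEuclideanLin (reflMatrix a E) v =
      Complex.exp (a * Real.pi * Complex.I / N) • (v - (2 : ℂ) • E.starProjection v) := by
    rw [← Matrix.coe_toEuclideanCLM_eq_toEuclideanLin, reflMatrix]
    simp [toEuclideanCLM_projMatrix]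
  rw [happ, neg_smul, ← smul_neg, smul_right_inj hc]
  constructor
  · intro h
    have h2 : (2 : ℂ) • E.starProjection v = (2 : ℂ) • v := by
      rw [two_smul ℂ v]
      rw [sub_eq_iff_eq_add, neg_add_eq_sub, eq_sub_iff_add_eq] at h
      exact h.symm
    exact (smul_right_inj two_ne_zero).mp h2
  · intro h
    rw [h, two_smul]
    abel

theorem reflMatrix_commute_iff {N : ℕ} (a b : ℕ)
    (E F : Submodule ℂ (EuclideanSpace ℂ (Fin N))) :
    reflMatrix a E * reflMatrix b F = reflMatrix b F * reflMatrix a E ↔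
      Commute E.starProjection F.starProjection := by
  have h1 : Commute (reflMatrix a E) (reflMatrix b F) ↔
      Commute (projMatrix E) (projMatrix F) := by
    rw [reflMatrix, reflMatrix, Commute.smul_left_iff₀ (Complex.exp_ne_zero _),
      Commute.smul_right_iff₀ (Complex.exp_ne_zero _)]
    constructor
    · intro h
      have := ((Commute.one_left _).sub_left h).sub_right (Commute.one_right _) |>.neg_right
      simpa [Commute.smul_left_iff₀, Commute.smul_right_iff₀] using this
    · intro h
      exact (Commute.one_left _).sub_left
        (((Commute.one_right _).sub_right (h.smul_right _)).smul_left _)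
  refine h1.trans ⟨fun h => ?_, fun h =>
    h.map (Matrix.toEuclideanCLM (n := Fin N) (𝕜 := ℂ)).symm⟩
  simpa [toEuclideanCLM_projMatrix] using h.map (Matrix.toEuclideanCLM (n := Fin N) (𝕜 := ℂ))

section Projections

variable {V : Type*} [NormedAddCommGroup V] [InnerProductSpace ℂ V]

theorem sup_inf_orthogonal_of_le [FiniteDimensional ℂ V] {G E : Submodule ℂ V} (h : G ≤ E) :
    G ⊔ E ⊓ Gᗮ = E := by
  rw [inf_comm, Submodule.sup_orthogonal_inf_of_hasOrthogonalProjection h]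

theorem starProjection_apply_starProjection_of_isOrtho [FiniteDimensional ℂ V]
    {E F : Submodule ℂ V}
    (h : (E ⊓ (E ⊓ F)ᗮ) ⟂ (F ⊓ (E ⊓ F)ᗮ)) (x : V) :
    E.starProjection (F.starProjection x) = (E ⊓ F).starProjection x := by
  have hG : (E ⊓ F).starProjection x ∈ E ⊓ F := Submodule.starProjection_apply_mem _ _
  refine (Submodule.eq_starProjection_of_mem_orthogonal hG.1 ?_)
  have hd : F.starProjection x - (E ⊓ F).starProjection x ∈ F ⊓ (E ⊓ F)ᗮ := by
    refine ⟨F.sub_mem (Submodule.starProjection_apply_mem _ _) hG.2, ?_⟩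
    have h1 : x - (E ⊓ F).starProjection x ∈ (E ⊓ F)ᗮ :=
      Submodule.sub_starProjection_mem_orthogonal x
    have h2 : x - F.starProjection x ∈ (E ⊓ F)ᗮ :=
      Submodule.orthogonal_le inf_le_right (Submodule.sub_starProjection_mem_orthogonal x)
    simpa using Submodule.sub_mem _ h1 h2
  have hE : E ≤ (E ⊓ F) ⊔ E ⊓ (E ⊓ F)ᗮ := (sup_inf_orthogonal_of_le inf_le_left).ge
  refine Submodule.orthogonal_le hE ?_
  rw [← Submodule.inf_orthogonal]
  exact ⟨hd.2, h.symm.le hd⟩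

theorem commute_starProjection_iff [FiniteDimensional ℂ V] (E F : Submodule ℂ V) :
    Commute E.starProjection F.starProjection ↔
      (E ⊓ (E ⊓ F)ᗮ) ⟂ (F ⊓ (E ⊓ F)ᗮ) := by
  constructor
  · intro h
    rw [Submodule.isOrtho_iff_inner_eq]
    intro u hu v hv
    have hcomm : E.starProjection (F.starProjection v) = F.starProjection (E.starProjection v) :=
      DFunLike.congr_fun h.eq v
    have hmem : E.starProjection v ∈ E ⊓ F := by
      refine ⟨Submodule.starProjection_apply_mem _ _, ?_⟩
      rw [F.starProjection_eq_self_iff.mpr hv.1] at hcomm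
      rw [hcomm]
      exact Submodule.starProjection_apply_mem _ _
    calc inner ℂ u v = inner ℂ (E.starProjection u) v := by
          rw [E.starProjection_eq_self_iff.mpr hu.1]
      _ = inner ℂ u (E.starProjection v) := Submodule.inner_starProjection_left_eq_right _ _ _
      _ = 0 := (Submodule.mem_orthogonal' _ _).mp hu.2 _ hmem
  · intro h
    ext x
    have h' : (F ⊓ (F ⊓ E)ᗮ) ⟂ (E ⊓ (F ⊓ E)ᗮ) := by
      rw [inf_comm F E]
      exact h.symm
    rw [mul_apply_eq_comp, mul_apply_eq_comp,
      starProjection_apply_starProjection_of_isOrtho h,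
      starProjection_apply_starProjection_of_isOrtho h']
    simp only [inf_comm]

theorem inf_sup_sup_of_isOrtho {K L M : Submodule ℂ V} (hKL : K ⟂ L) (hLM : L ⟂ M) :
    (K ⊔ L) ⊓ (K ⊔ M) = K := by
  have h : L ⟂ K ⊔ M := Submodule.isOrtho_sup_right.mpr ⟨hKL.symm, hLM⟩
  rw [sup_inf_assoc_of_le L le_sup_left, h.disjoint.eq_bot, sup_bot_eq]

theorem sup_inf_orthogonal_of_isOrtho {K L : Submodule ℂ V} (h : K ⟂ L) :
    (K ⊔ L) ⊓ Kᗮ = L := by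
  rw [sup_comm, sup_inf_assoc_of_le K h.symm.le, Submodule.inf_orthogonal_eq_bot, sup_bot_eq]

theorem finrank_sup_of_isOrtho [FiniteDimensional ℂ V] {K L : Submodule ℂ V} (h : K ⟂ L) :
    Module.finrank ℂ ↥(K ⊔ L) = Module.finrank ℂ K + Module.finrank ℂ L := by
  have := Submodule.finrank_sup_add_finrank_inf_eq K L
  rwa [h.disjoint.eq_bot, finrank_bot, add_zero] at this

end Projections

/-- The map sending a commuting pair `(M_A, M_B) ∈ C_a × C_b` to the triple
`(Λ₁, Λ₂, Λ₃) = (E(M_A) ⊓ E(M_B), E(M_A) ⊓ Λ₁ᗮ, E(M_B) ⊓ Λ₁ᗮ)` is a bijection onto the set of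
triples of pairwise orthogonal subspaces of `ℂ^N` with `dim Λ₂ = a − dim Λ₁` and
`dim Λ₃ = b − dim Λ₁`. -/
theorem stmt0 (N a b : ℕ) (hN : 0 < N) (ha : a ≤ N) (hb : b ≤ N) :
    Set.BijOn
      (fun p : Matrix (Fin N) (Fin N) ℂ × Matrix (Fin N) (Fin N) ℂ =>
        (eigSp N a p.1 ⊓ eigSp N b p.2,
         eigSp N a p.1 ⊓ (eigSp N a p.1 ⊓ eigSp N b p.2)ᗮ,
         eigSp N b p.2 ⊓ (eigSp N a p.1 ⊓ eigSp N b p.2)ᗮ))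
      {p | p.1 ∈ conjClass N a ∧ p.2 ∈ conjClass N b ∧ p.1 * p.2 = p.2 * p.1}
      {t : Submodule ℂ (EuclideanSpace ℂ (Fin N)) ×
           Submodule ℂ (EuclideanSpace ℂ (Fin N)) ×
           Submodule ℂ (EuclideanSpace ℂ (Fin N)) |
        Submodule.IsOrtho t.1 t.2.1 ∧ Submodule.IsOrtho t.1 t.2.2 ∧
        Submodule.IsOrtho t.2.1 t.2.2 ∧
        (Module.finrank ℂ t.2.1 : ℤ) = (a : ℤ) - Module.finrank ℂ t.1 ∧
        (Module.finrank ℂ t.2.2 : ℤ) = (b : ℤ) - Module.finrank ℂ t.1} := by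
  refine ⟨?_, ?_, ?_⟩
  · rintro ⟨A, B⟩ ⟨hA, hB, hAB⟩
    obtain ⟨E, hE, rfl⟩ := (mem_conjClass_iff hN ha A).mp hA
    obtain ⟨F, hF, rfl⟩ := (mem_conjClass_iff hN hb B).mp hB
    have hEF := (commute_starProjection_iff E F).mp ((reflMatrix_commute_iff a b E F).mp hAB)
    have hG : ∀ K : Submodule ℂ (EuclideanSpace ℂ (Fin N)), E ⊓ F ⟂ K ⊓ (E ⊓ F)ᗮ := fun K =>
      (Submodule.isOrtho_orthogonal_right _).mono_right inf_le_right
    have h1 := Submodule.finrank_add_inf_finrank_orthogonal (inf_le_left : E ⊓ F ≤ E)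
    have h2 := Submodule.finrank_add_inf_finrank_orthogonal (inf_le_right : E ⊓ F ≤ F)
    rw [inf_comm (E ⊓ F)ᗮ E] at h1
    rw [inf_comm (E ⊓ F)ᗮ F] at h2
    simp only [Set.mem_ofPred_eq, eigSp_reflMatrix]
    exact ⟨hG E, hG F, hEF, by omega, by omega⟩
  · rintro ⟨A, B⟩ ⟨hA, hB, -⟩ ⟨A', B'⟩ ⟨hA', hB', -⟩ h
    obtain ⟨E, -, rfl⟩ := (mem_conjClass_iff hN ha A).mp hA
    obtain ⟨F, -, rfl⟩ := (mem_conjClass_iff hN hb B).mp hB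
    obtain ⟨E', -, rfl⟩ := (mem_conjClass_iff hN ha A').mp hA'
    obtain ⟨F', -, rfl⟩ := (mem_conjClass_iff hN hb B').mp hB'
    simp only [eigSp_reflMatrix, Prod.mk.injEq] at h
    obtain ⟨h1, h2, h3⟩ := h
    have hE : E = E' := by
      rw [← sup_inf_orthogonal_of_le (inf_le_left : E ⊓ F ≤ E), h2, h1,
        sup_inf_orthogonal_of_le inf_le_left]
    have hF : F = F' := by
      rw [← sup_inf_orthogonal_of_le (inf_le_right : E ⊓ F ≤ F), h3, h1,
        sup_inf_orthogonal_of_le inf_le_right]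
    rw [hE, hF]
  · rintro ⟨K, L, M⟩ ⟨hKL, hKM, hLM, hL, hM⟩
    dsimp only at hKL hKM hLM hL hM
    have hinf := inf_sup_sup_of_isOrtho hKL hLM
    have hE := sup_inf_orthogonal_of_isOrtho hKL
    have hF := sup_inf_orthogonal_of_isOrtho hKM
    refine ⟨(reflMatrix a (K ⊔ L), reflMatrix b (K ⊔ M)),
      ⟨(mem_conjClass_iff hN ha _).mpr ⟨_, ?_, rfl⟩,
        (mem_conjClass_iff hN hb _).mpr ⟨_, ?_, rfl⟩, ?_⟩, ?_⟩
    · rw [finrank_sup_of_isOrtho hKL]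
      omega
    · rw [finrank_sup_of_isOrtho hKM]
      omega
    · rw [reflMatrix_commute_iff, commute_starProjection_iff, hinf, hE, hF]
      exact hLM
    · simp only [eigSp_reflMatrix, hinf, hE, hF]
end

section
/- Let 0 ≤ a ≤ N be integers. If (M_A, M_B) ∈ C_a × C_a satisfies the braid relation M_A M_B M_A = M_B M_A M_B, then l := dim(E(M_A) ∩ E(M_B)) satisfies max(2a − N, 0) ≤ l ≤ a; conversely, for every integer l with max(2a − N, 0) ≤ l ≤ a there exists a pair (M_A, M_B) ∈ C_a × C_a satisfying M_A M_B M_A = M_B M_A M_B with dim(E(M_A) ∩ E(M_B)) = l. -/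
open Matrix in
theorem finrank_ker_toEuclideanLin_add_rank {n : ℕ} (A : Matrix (Fin n) (Fin n) ℂ) :
    Module.finrank ℂ (LinearMap.ker (toEuclideanLin A)) + A.rank = n := by
  have h := LinearMap.finrank_range_add_finrank_ker (toEuclideanLin A)
  rw [finrank_euclideanSpace_fin] at h
  rw [Matrix.rank_eq_finrank_range_toLin A (EuclideanSpace.basisFun (Fin n) ℂ).toBasis
    (EuclideanSpace.basisFun (Fin n) ℂ).toBasis, ← Matrix.toEuclideanLin_eq_toLin_orthonormal]
  omega

open Matrix in
theorem finrank_ker_toEuclideanLin_diagonal {n k : ℕ} (hk : k ≤ n) (w : Fin n → ℂ)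
    (hw : ∀ i, w i = 0 ↔ (i : ℕ) < k) :
    Module.finrank ℂ (LinearMap.ker (toEuclideanLin (diagonal w))) = k := by
  have h := finrank_ker_toEuclideanLin_add_rank (diagonal w)
  have hc : Fintype.card {i // w i = 0} = k := by
    simp only [hw, Fintype.card_subtype]
    have := Fin.card_filter_val_lt (n := n) (m := k)
    simpa [hk] using this
  have hr := rank_diagonal w
  rw [Fintype.card_subtype_compl, hc, Fintype.card_fin] at hr
  omega

theorem eigSp_eq_ker (N a : ℕ) (M : Matrix (Fin N) (Fin N) ℂ) :
    eigSp N a M = LinearMap.ker (Matrix.toEuclideanLin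
      (M + Matrix.diagonal fun _ => Complex.exp (a * Real.pi * Complex.I / N))) := by
  ext v
  rw [eigSp, Module.End.mem_eigenspace_iff, LinearMap.mem_ker, map_add, LinearMap.add_apply,
    neg_smul, ← add_eq_zero_iff_eq_neg]
  have : Matrix.toEuclideanLin
      (Matrix.diagonal fun _ : Fin N => Complex.exp (a * Real.pi * Complex.I / N)) v =
      Complex.exp (a * Real.pi * Complex.I / N) • v := by
    ext i
    simp [Matrix.toLpLin_apply]
  rw [this]

theorem finrank_eigSp {N a : ℕ} (ha : a ≤ N) {M : Matrix (Fin N) (Fin N) ℂ}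
    (hM : M ∈ conjClass N a) : Module.finrank ℂ (eigSp N a M) = a := by
  obtain ⟨U, hU, rfl⟩ := hM
  have hdet : IsUnit U.det := by
    rw [(Matrix.mem_specialUnitaryGroup_iff.1 hU).2]; exact isUnit_one
  set c := Complex.exp (a * Real.pi * Complex.I / N) with hc
  have hc0 : c ≠ 0 := Complex.exp_ne_zero _
  set w : Fin N → ℂ := fun i => if (i : ℕ) < a then 0 else 2 * c
  have hw : Phi N a + Matrix.diagonal (fun _ => c) = Matrix.diagonal w := by
    rw [Phi, ← hc, ← Matrix.diagonal_smul, Matrix.diagonal_add]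
    congr 1
    ext i
    by_cases h : (i : ℕ) < a <;> simp [w, h, two_mul]
  have hconj : U * Phi N a * U⁻¹ + Matrix.diagonal (fun _ => c) =
      U * Matrix.diagonal w * U⁻¹ := by
    rw [← hw, mul_add, add_mul]
    congr 1
    rw [← Matrix.smul_one_eq_diagonal, mul_smul_comm, smul_mul_assoc, mul_one,
      Matrix.mul_nonsing_inv _ hdet]
  have h₁ := finrank_ker_toEuclideanLin_add_rank (U * Matrix.diagonal w * U⁻¹)
  have h₂ := finrank_ker_toEuclideanLin_add_rank (Matrix.diagonal w)
  rw [finrank_ker_toEuclideanLin_diagonal ha w (fun i => by simp [w, hc0])] at h₂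
  rw [Matrix.rank_mul_eq_left_of_isUnit_det _ _ (by simpa using hdet),
    Matrix.rank_mul_eq_right_of_isUnit_det _ _ hdet] at h₁
  rw [eigSp_eq_ker, ← hc, hconj]
  omega

/-- The infinitesimal rotation in the planes spanned by `e_i` and `e_{σ i}` with sign `ε`. -/
def planeGenerator {n : ℕ} (σ : Fin n → Fin n) (ε : Fin n → ℂ) : Matrix (Fin n) (Fin n) ℂ :=
  Matrix.of fun i j => if j = σ i then ε i else 0

section planeGenerator

variable {n : ℕ} {σ : Fin n → Fin n} {ε : Fin n → ℂ}

theorem planeGenerator_mul_self (hσ : ∀ i, σ (σ i) = i) (hε : ∀ i, ε (σ i) = -ε i) :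
    planeGenerator σ ε * planeGenerator σ ε = -Matrix.diagonal fun i => ε i ^ 2 := by
  ext i j
  simp only [planeGenerator, Matrix.mul_apply, Matrix.of_apply, ite_mul, zero_mul,
    Finset.sum_ite_eq', Finset.mem_univ, if_true, hσ, hε, Matrix.neg_apply,
    Matrix.diagonal_apply, eq_comm (a := j)]
  split_ifs <;> ring

theorem diagonal_mul_planeGenerator (hε : ∀ i, ε i ^ 3 = ε i) :
    Matrix.diagonal (fun i => ε i ^ 2) * planeGenerator σ ε = planeGenerator σ ε := by
  ext i j
  simp only [planeGenerator, Matrix.diagonal_mul, Matrix.of_apply]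
  split_ifs
  · rw [← pow_succ, hε]
  · simp

theorem planeGenerator_mul_diagonal (hε : ∀ i, ε (σ i) = -ε i) (hε₃ : ∀ i, ε i ^ 3 = ε i) :
    planeGenerator σ ε * Matrix.diagonal (fun i => ε i ^ 2) = planeGenerator σ ε := by
  ext i j
  simp only [planeGenerator, Matrix.mul_diagonal, Matrix.of_apply]
  split_ifs with h
  · rw [h, hε, neg_sq, mul_comm, ← pow_succ, hε₃]
  · simp

theorem diagonal_anticomm_planeGenerator {d : Fin n → ℂ}
    (hd : ∀ i, ε i = 0 ∨ d (σ i) = -d i) :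
    Matrix.diagonal d * planeGenerator σ ε = -(planeGenerator σ ε * Matrix.diagonal d) := by
  ext i j
  simp only [planeGenerator, Matrix.mul_diagonal, Matrix.diagonal_mul, Matrix.of_apply,
    Matrix.neg_apply]
  split_ifs with h
  · subst h
    rcases hd i with h | h <;> rw [h] <;> ring
  · simp

theorem star_planeGenerator (hσ : ∀ i, σ (σ i) = i) (hε : ∀ i, ε (σ i) = -ε i)
    (hreal : ∀ i, star (ε i) = ε i) :
    star (planeGenerator σ ε) = -planeGenerator σ ε := by
  ext i j
  have h : i = σ j ↔ j = σ i := ⟨fun h => by rw [h, hσ], fun h => by rw [h, hσ]⟩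
  simp only [Matrix.star_apply, planeGenerator, Matrix.of_apply, Matrix.neg_apply, h]
  split_ifs with h'
  · rw [hreal, h', hε]
  · simp

end planeGenerator

/-- If `K` is idempotent and `J` is a complex structure on its image, then rotation by `2π/3`
on that image composed with rotation by `-2π/3` is the identity. -/
theorem rotation_mul_rotation_neg {R : Type*} [Ring R] [Algebra ℂ R] {J K : R} {s : ℂ}
    (hs : s * s = 3 / 4) (hJJ : J * J = -K) (hKJ : K * J = J) (hJK : J * K = J)
    (hKK : K * K = K) :
    (1 - (3 / 2 : ℂ) • K + s • J) * (1 - (3 / 2 : ℂ) • K - s • J) = 1 := by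
  simp only [mul_sub, add_mul, sub_mul, smul_mul_assoc, mul_smul_comm, one_mul, mul_one,
    hJJ, hKJ, hJK, hKK, smul_neg]
  match_scalars <;> first | ring1 | linear_combination hs

theorem rotation_mul_self {R : Type*} [Ring R] [Algebra ℂ R] {J K : R} {s : ℂ}
    (hs : s * s = 3 / 4) (hJJ : J * J = -K) (hKJ : K * J = J) (hJK : J * K = J)
    (hKK : K * K = K) :
    (1 - (3 / 2 : ℂ) • K + s • J) * (1 - (3 / 2 : ℂ) • K + s • J) =
      1 - (3 / 2 : ℂ) • K - s • J := by
  simp only [mul_add, mul_sub, add_mul, sub_mul, smul_mul_assoc, mul_smul_comm, one_mul, mul_one,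
    hJJ, hKJ, hJK, hKK, smul_neg]
  match_scalars <;> first | ring1 | linear_combination -hs

theorem braid_of_dihedral {R : Type*} [Monoid R] {D T T' : R} (hDD : D * D = 1)
    (hT : T * T = T') (hTT' : T * T' = 1) (hDT : D * T = T' * D) :
    D * (T * D * T') * D = (T * D * T') * D * (T * D * T') := by
  have hT'T : T' * T = 1 := by rw [← hT, mul_assoc, hT, hTT']
  have hDT' : D * T' = T * D := by
    calc D * T' = T * (T' * D) * T' := by rw [← mul_assoc, hTT', one_mul]
      _ = T * D := by rw [← hDT, mul_assoc, mul_assoc, hTT', mul_one]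
  have hB : T * D * T' = T' * D := by
    rw [mul_assoc, hDT', ← mul_assoc, hT]
  rw [hB]
  calc D * (T' * D) * D = D * T' := by rw [mul_assoc, mul_assoc, hDD, mul_one]
    _ = T * D := hDT'
    _ = T' * T' * D := by
      congr 1
      calc T = T * (T * T') := by rw [hTT', mul_one]
        _ = T' * T' := by rw [← mul_assoc, hT]
    _ = T' * D * D * (T' * D) := by rw [mul_assoc T' D D, hDD, mul_one, mul_assoc]

theorem det_eq_one_of_dihedral {n : ℕ} {D T T' : Matrix (Fin n) (Fin n) ℂ} (hDD : D * D = 1)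
    (hT : T * T = T') (hTT' : T * T' = 1) (hDT : D * T = T' * D) : T.det = 1 := by
  have h₁ := congrArg Matrix.det hDD
  have h₂ := congrArg Matrix.det hT
  have h₃ := congrArg Matrix.det hTT'
  have h₄ := congrArg Matrix.det hDT
  simp only [Matrix.det_mul, Matrix.det_one] at h₁ h₂ h₃ h₄
  have h₅ : T.det = T'.det := by
    linear_combination D.det * h₄ + (T'.det - T.det) * h₁
  rw [← h₅] at h₂ h₃
  rw [← h₂, h₃]

theorem mem_eigSp_smul_iff {N a : ℕ} {X : Matrix (Fin N) (Fin N) ℂ}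
    {v : EuclideanSpace ℂ (Fin N)} :
    v ∈ eigSp N a (Complex.exp (a * Real.pi * Complex.I / N) • X) ↔
      X.mulVec v.ofLp = -v.ofLp := by
  have hc : Complex.exp (a * Real.pi * Complex.I / N) ≠ 0 := Complex.exp_ne_zero _
  rw [eigSp, Module.End.mem_eigenspace_iff, Matrix.toLpLin_apply,
    ← (WithLp.ofLp_injective 2).eq_iff, WithLp.ofLp_smul, Matrix.smul_mulVec, neg_smul,
    ← smul_neg]
  exact (smul_right_injective _ hc).eq_iff

theorem conj_mulVec_eq_neg_iff {n : ℕ} {D J K : Matrix (Fin n) (Fin n) ℂ} {s : ℂ}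
    (hs : s * s = 3 / 4) (hJJ : J * J = -K) (hKJ : K * J = J) (hJK : J * K = J)
    (hKK : K * K = K) (hDT' : D * (1 - (3 / 2 : ℂ) • K - s • J) =
      (1 - (3 / 2 : ℂ) • K + s • J) * D) {v : Fin n → ℂ} (hv : D.mulVec v = -v) :
    ((1 - (3 / 2 : ℂ) • K + s • J) * D * (1 - (3 / 2 : ℂ) • K - s • J)).mulVec v = -v ↔
      K.mulVec v = 0 := by
  have hTT' := rotation_mul_rotation_neg hs hJJ hKJ hJK hKK
  have hT := rotation_mul_self hs hJJ hKJ hJK hKK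
  have hs0 : s ≠ 0 := by rintro rfl; norm_num at hs
  have hval : ((1 - (3 / 2 : ℂ) • K + s • J) * D * (1 - (3 / 2 : ℂ) • K - s • J)).mulVec v =
      -(1 - (3 / 2 : ℂ) • K - s • J).mulVec v := by
    rw [mul_assoc, hDT', ← mul_assoc, hT, ← Matrix.mulVec_mulVec, hv, Matrix.mulVec_neg]
  rw [hval, neg_inj]
  have hJ0 : K.mulVec v = 0 → J.mulVec v = 0 := fun h => by
    rw [← hJK, ← Matrix.mulVec_mulVec, h, Matrix.mulVec_zero]
  constructor
  · intro h
    have h' : (1 - (3 / 2 : ℂ) • K + s • J).mulVec v = v := by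
      conv_lhs => rw [← h]
      rw [Matrix.mulVec_mulVec, hTT', Matrix.one_mulVec]
    have h'' : (2 * s) • J.mulVec v = 0 := by
      rw [← sub_self v]
      conv_rhs => rw [← h']
      conv_rhs => arg 2; rw [h', ← h]
      rw [← Matrix.sub_mulVec, ← Matrix.smul_mulVec]
      congr 1
      module
    have hJ : J.mulVec v = 0 := by simpa [hs0] using h''
    rw [← neg_neg K, ← hJJ, Matrix.neg_mulVec, ← Matrix.mulVec_mulVec, hJ]
    simp
  · intro h
    simp [Matrix.sub_mulVec, Matrix.smul_mulVec, h, hJ0 h]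

theorem exists_braid_pair {N a l : ℕ} (ha : a ≤ N) (hla : l ≤ a) (hl : 2 * a ≤ N + l) :
    ∃ MA MB : Matrix (Fin N) (Fin N) ℂ, MA ∈ conjClass N a ∧ MB ∈ conjClass N a ∧
      MA * MB * MA = MB * MA * MB ∧
      Module.finrank ℂ ↥(eigSp N a MA ⊓ eigSp N a MB) = l := by
  set c := Complex.exp (a * Real.pi * Complex.I / N) with hc
  let d : Fin N → ℂ := fun i => if (i : ℕ) < a then -1 else 1
  let D := Matrix.diagonal d
  let σ : Fin N → Fin N := fun i =>
    if h : l ≤ (i : ℕ) ∧ (i : ℕ) < a then ⟨i + (a - l), by omega⟩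
    else if a ≤ (i : ℕ) ∧ (i : ℕ) < 2 * a - l then ⟨i - (a - l), by omega⟩ else i
  let ε : Fin N → ℂ := fun i =>
    if l ≤ (i : ℕ) ∧ (i : ℕ) < a then 1
    else if a ≤ (i : ℕ) ∧ (i : ℕ) < 2 * a - l then -1 else 0
  have hcases : ∀ i : Fin N,
      (l ≤ (i : ℕ) ∧ (i : ℕ) < a ∧ (σ i : ℕ) = i + (a - l)) ∨
      (a ≤ (i : ℕ) ∧ (i : ℕ) < 2 * a - l ∧ (σ i : ℕ) = i - (a - l)) ∨
      (((i : ℕ) < l ∨ 2 * a - l ≤ (i : ℕ)) ∧ σ i = i) := by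
    intro i
    by_cases h₁ : l ≤ (i : ℕ) ∧ (i : ℕ) < a
    · left; simp [σ, h₁]
    · by_cases h₂ : a ≤ (i : ℕ) ∧ (i : ℕ) < 2 * a - l
      · right; left; simp [σ, h₁, h₂]
      · right; right; exact ⟨by omega, by simp only [σ, h₁, h₂, dif_neg, if_neg, not_false_eq_true]⟩
  have hε1 : ∀ i : Fin N, l ≤ (i : ℕ) → (i : ℕ) < a → ε i = 1 := fun i h₁ h₂ => by
    simp [ε, h₁, h₂]
  have hε2 : ∀ i : Fin N, a ≤ (i : ℕ) → (i : ℕ) < 2 * a - l → ε i = -1 := fun i h₁ h₂ => by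
    simp [ε, h₁, h₂, h₁.not_gt]
  have hε3 : ∀ i : Fin N, ((i : ℕ) < l ∨ 2 * a - l ≤ (i : ℕ)) → ε i = 0 := fun i h => by
    simp only [ε]
    rw [if_neg (by omega), if_neg (by omega)]
  have hσσ : ∀ i, σ (σ i) = i := by
    intro i
    apply Fin.ext
    rcases hcases i with h | h | h
    · have := hcases (σ i); omega
    · have := hcases (σ i); omega
    · rw [h.2, h.2]
  have hεσ : ∀ i, ε (σ i) = -ε i := by
    intro i
    rcases hcases i with h | h | h
    · rw [hε1 i h.1 h.2.1, hε2 (σ i) (by omega) (by omega)]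
    · rw [hε2 i h.1 h.2.1, hε1 (σ i) (by omega) (by omega), neg_neg]
    · rw [h.2, hε3 i h.1, neg_zero]
  have hε : ∀ i, ε i = 1 ∨ ε i = -1 ∨ ε i = 0 := by
    intro i
    rcases hcases i with h | h | h
    · exact .inl (hε1 i h.1 h.2.1)
    · exact .inr (.inl (hε2 i h.1 h.2.1))
    · exact .inr (.inr (hε3 i h.1))
  have hcube : ∀ i, ε i ^ 3 = ε i := fun i => by
    rcases hε i with h | h | h <;> rw [h] <;> norm_num
  have hreal : ∀ i, star (ε i) = ε i := fun i => by
    rcases hε i with h | h | h <;> rw [h] <;> simp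
  have hd : ∀ i, ε i = 0 ∨ d (σ i) = -d i := by
    intro i
    rcases hcases i with h | h | h
    · right
      simp only [d]
      rw [if_pos h.2.1, if_neg (by omega), neg_neg]
    · right
      simp only [d]
      rw [if_neg h.1.not_gt, if_pos (by omega)]
    · exact .inl (hε3 i h.1)
  let J := planeGenerator σ ε
  let K : Matrix (Fin N) (Fin N) ℂ := Matrix.diagonal fun i => ε i ^ 2
  let s : ℂ := ((√3 / 2 : ℝ) : ℂ)
  have hs : s * s = 3 / 4 := by
    simp only [s]
    rw [← Complex.ofReal_mul, div_mul_div_comm, Real.mul_self_sqrt (by norm_num)]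
    norm_num
  have hJJ : J * J = -K := planeGenerator_mul_self hσσ hεσ
  have hKJ : K * J = J := diagonal_mul_planeGenerator hcube
  have hJK : J * K = J := planeGenerator_mul_diagonal hεσ hcube
  have hKK : K * K = K := by
    simp only [K, Matrix.diagonal_mul_diagonal]
    congr 1
    ext i
    linear_combination ε i * hcube i
  have hDJ : D * J = -(J * D) := diagonal_anticomm_planeGenerator hd
  have hDK : D * K = K * D := Matrix.commute_diagonal _ _
  have hDD : D * D = 1 := by
    simp only [D, Matrix.diagonal_mul_diagonal, ← Matrix.diagonal_one]
    congr 1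
    ext i
    by_cases h : (i : ℕ) < a <;> simp [d, h]
  let T := 1 - (3 / 2 : ℂ) • K + s • J
  let T' := 1 - (3 / 2 : ℂ) • K - s • J
  have hTT' : T * T' = 1 := rotation_mul_rotation_neg hs hJJ hKJ hJK hKK
  have hT : T * T = T' := rotation_mul_self hs hJJ hKJ hJK hKK
  have hDT : D * T = T' * D := by
    simp only [T, T', mul_add, mul_sub, sub_mul, mul_one, one_mul, mul_smul_comm,
      smul_mul_assoc, hDJ, hDK]
    module
  have hDT' : D * T' = T * D := by
    simp only [T, T', mul_sub, sub_mul, add_mul, mul_one, one_mul, mul_smul_comm,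
      smul_mul_assoc, hDJ, hDK]
    module
  have hstar : star T = T' := by
    have hJs : star J = -J := star_planeGenerator hσσ hεσ hreal
    have hKs : star K = K := by
      simp only [K, Matrix.star_eq_conjTranspose, Matrix.diagonal_conjTranspose]
      congr 1
      ext i
      simp only [Pi.star_apply, star_pow, hreal]
    have hss : star s = s := Complex.conj_ofReal _
    have h32 : star (3 / 2 : ℂ) = 3 / 2 := by simp
    simp only [T, T', star_add, star_sub, star_one, star_smul, hJs, hKs, hss, h32]
    module
  have hTmem : T ∈ Matrix.specialUnitaryGroup (Fin N) ℂ := by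
    rw [Matrix.mem_specialUnitaryGroup_iff, Matrix.mem_unitaryGroup_iff, hstar]
    exact ⟨hTT', det_eq_one_of_dihedral hDD hT hTT' hDT⟩
  have hPhi : Phi N a = c • D := rfl
  refine ⟨c • D, c • (T * D * T'), ⟨1, one_mem _, by simp [hPhi]⟩, ⟨T, hTmem, ?_⟩, ?_, ?_⟩
  · rw [Matrix.inv_eq_right_inv hTT', hPhi, mul_smul_comm, smul_mul_assoc]
  · simp only [smul_mul_assoc, mul_smul_comm]
    rw [braid_of_dihedral hDD hT hTT' hDT]
  · suffices hE : eigSp N a (c • D) ⊓ eigSp N a (c • (T * D * T')) =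
        LinearMap.ker (Matrix.toEuclideanLin
          (Matrix.diagonal fun i : Fin N => if (i : ℕ) < l then 0 else 1)) by
      rw [hE]
      exact finrank_ker_toEuclideanLin_diagonal (hla.trans ha) _ fun i => by simp
    ext v
    rw [Submodule.mem_inf, mem_eigSp_smul_iff, mem_eigSp_smul_iff, and_congr_right fun hv =>
      conj_mulVec_eq_neg_iff hs hJJ hKJ hJK hKK hDT' hv, LinearMap.mem_ker,
      Matrix.toLpLin_apply, ← (WithLp.ofLp_injective 2).eq_iff]
    simp only [funext_iff, D, K, Matrix.mulVec_diagonal, Pi.neg_apply, Pi.zero_apply,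
      WithLp.ofLp_zero]
    rw [← forall_and]
    refine forall_congr' fun i => ?_
    rcases hcases i with h | h | h
    · simp [d, hε1 i h.1 h.2.1, h.2.1, h.1.not_gt]
    · simp [d, hε2 i h.1 h.2.1, h.1.not_gt, (hla.trans h.1).not_gt, self_eq_neg]
    · rcases h.1 with h' | h'
      · simp [hε3 i h.1, d, h', h'.trans_le hla]
      · have h₁ : ¬ (i : ℕ) < a := by omega
        have h₂ : ¬ (i : ℕ) < l := by omega
        simp [hε3 i h.1, d, h₁, h₂, self_eq_neg]

/-- If `(M_A, M_B) ∈ C_a × C_a` satisfies the braid relation then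
`l = dim(E(M_A) ∩ E(M_B))` satisfies `max(2a − N, 0) ≤ l ≤ a`; conversely every such `l` is
realized by some pair satisfying the braid relation. -/
theorem stmt1 (N a : ℕ) (hN : 0 < N) (ha : a ≤ N) :
    (∀ MA MB : Matrix (Fin N) (Fin N) ℂ, MA ∈ conjClass N a → MB ∈ conjClass N a →
      MA * MB * MA = MB * MA * MB →
        max (2 * (a : ℤ) - N) 0 ≤ Module.finrank ℂ ↥(eigSp N a MA ⊓ eigSp N a MB) ∧
        Module.finrank ℂ ↥(eigSp N a MA ⊓ eigSp N a MB) ≤ a) ∧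
    (∀ l : ℕ, max (2 * (a : ℤ) - N) 0 ≤ l → l ≤ a →
      ∃ MA MB : Matrix (Fin N) (Fin N) ℂ, MA ∈ conjClass N a ∧ MB ∈ conjClass N a ∧
        MA * MB * MA = MB * MA * MB ∧
        Module.finrank ℂ ↥(eigSp N a MA ⊓ eigSp N a MB) = l) := by
  refine ⟨fun MA MB hA hB _ => ?_, fun l hl hla => exists_braid_pair ha hla (by omega)⟩
  have hdA := finrank_eigSp ha hA
  have hdB := finrank_eigSp ha hB
  have hsum := Submodule.finrank_sup_add_finrank_inf_eq (eigSp N a MA) (eigSp N a MB)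
  have hsup := Submodule.finrank_le (eigSp N a MA ⊔ eigSp N a MB)
  have hinf := Submodule.finrank_mono (inf_le_left : eigSp N a MA ⊓ eigSp N a MB ≤ eigSp N a MA)
  rw [finrank_euclideanSpace_fin] at hsup
  omega
end

section
/- Let 0 ≤ a ≤ N be integers, and let (M_A, M_B) and (M_A', M_B') be pairs in C_a × C_a each satisfying the braid relation M_A M_B M_A = M_B M_A M_B (respectively M_A' M_B' M_A' = M_B' M_A' M_B'). Then there exists a unitary matrix U ∈ U(N) with M_A' = U M_A U^{-1} and M_B' = U M_B U^{-1} if and only if dim(E(M_A) ∩ E(M_B)) = dim(E(M_A') ∩ E(M_B')). In other words, the pairs in C_a × C_a satisfying the braid relation and having a fixed eigenspace-intersection dimension form a single orbit of the conjugation action of U(N). -/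
section Subspaces

open Submodule

variable {𝕜 H : Type*} [RCLike 𝕜] [NormedAddCommGroup H] [InnerProductSpace 𝕜 H]
  [FiniteDimensional 𝕜 H]

/-- Two linear maps with the same Gram form differ by a linear isometry of the target. -/
theorem exists_linearIsometryEquiv_of_inner_eq {X : Type*} [AddCommGroup X] [Module 𝕜 X]
    (A B : X →ₗ[𝕜] H) (h : ∀ x y, inner 𝕜 (A x) (A y) = inner 𝕜 (B x) (B y)) :
    ∃ U : H ≃ₗᵢ[𝕜] H, ∀ x, U (A x) = B x := by
  obtain ⟨g, hg⟩ := A.rangeRestrict.exists_rightInverse_of_surjective A.range_rangeRestrict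
  have hg' (s : A.range) : A (g s) = s := congrArg Subtype.val (LinearMap.congr_fun hg s)
  let L : A.range →ₗᵢ[𝕜] H := (B ∘ₗ g).isometryOfInner fun s t => by
    simp [← h, hg']
  refine ⟨L.extend.toLinearIsometryEquiv rfl, fun x => ?_⟩
  have hx : L.extend (A x) = B (g (A.rangeRestrict x)) := L.extend_apply (A.rangeRestrict x)
  have hz : A (g (A.rangeRestrict x) - x) = 0 := by simp [hg']
  have hB : B (g (A.rangeRestrict x) - x) = 0 := by
    rw [← inner_self_eq_zero (𝕜 := 𝕜), ← h, hz, inner_zero_left]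
  rw [map_sub, sub_eq_zero] at hB
  simpa [hB] using hx

theorem nonempty_linearIsometryEquiv_of_finrank_eq {K L : Submodule 𝕜 H}
    (h : Module.finrank 𝕜 K = Module.finrank 𝕜 L) : Nonempty (K ≃ₗᵢ[𝕜] L) :=
  ⟨((stdOrthonormalBasis 𝕜 K).reindex (finCongr h)).repr.trans
    (stdOrthonormalBasis 𝕜 L).repr.symm⟩

/-- The relation between orthogonal projections which is equivalent to the braid relation
for the corresponding reflections. -/
def ProjBraid (E F : Submodule 𝕜 H) : Prop :=
  ∀ x, F.starProjection x + (4 : 𝕜) • E.starProjection (F.starProjection (E.starProjection x)) =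
    E.starProjection x + (4 : 𝕜) • F.starProjection (E.starProjection (F.starProjection x))

namespace ProjBraid

variable {E F : Submodule 𝕜 H}

theorem symm (h : ProjBraid E F) : ProjBraid F E := fun x => (h x).symm

/-- On the complement of `E ⊓ F` in `E`, compressing the projection onto `F` to `E` gives `1 / 4`. -/
theorem four_smul_starProjection (h : ProjBraid E F) {x : H} (hx : x ∈ (E ⊓ F)ᗮ ⊓ E) :
    (4 : 𝕜) • E.starProjection (F.starProjection x) = x := by
  obtain ⟨hxK, hxE⟩ := hx
  have hP {y : H} (hy : y ∈ E) : E.starProjection y = y := starProjection_eq_self_iff.2 hy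
  have hPP (y : H) : E.starProjection (E.starProjection y) = E.starProjection y :=
    hP (starProjection_apply_mem E y)
  have hQQ (y : H) : F.starProjection (F.starProjection y) = F.starProjection y :=
    starProjection_eq_self_iff.2 (starProjection_apply_mem F y)
  set w := (4 : 𝕜) • E.starProjection (F.starProjection x) - x with hw
  have hwE : w ∈ E := E.sub_mem (E.smul_mem _ (starProjection_apply_mem E _)) hxE
  have hPQw : E.starProjection (F.starProjection w) = w := by
    have h1 := congrArg E.starProjection (h x)
    simp only [map_add, map_smul, hPP, hP hxE] at h1
    simp only [hw, map_sub, map_smul]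
    linear_combination (norm := module) -h1
  have hwF : w ∈ F := by
    rw [← starProjection_eq_self_iff]
    have h1 := h w
    rw [hP hwE, hPQw] at h1
    have h2 : (3 : 𝕜) • (F.starProjection w - w) = 0 := by
      linear_combination (norm := module) -h1
    exact sub_eq_zero.1 ((smul_eq_zero.1 h2).resolve_left (by norm_num))
  have hwK : w ∈ (E ⊓ F)ᗮ := by
    refine (mem_orthogonal _ _).2 fun k hk => ?_
    have hk0 : inner 𝕜 k x = 0 := (mem_orthogonal _ _).1 hxK k hk
    rw [hw, inner_sub_right, inner_smul_right, ← inner_starProjection_left_eq_right, hP hk.1,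
      ← inner_starProjection_left_eq_right, starProjection_eq_self_iff.2 hk.2, hk0]
    simp
  have : w = 0 := by
    have := (mem_orthogonal _ _).1 hwK w ⟨hwE, hwF⟩
    exact inner_self_eq_zero.1 this
  exact sub_eq_zero.1 this

theorem inner_starProjection (h : ProjBraid E F) {x y : H} (hx : x ∈ E)
    (hy : y ∈ (E ⊓ F)ᗮ ⊓ E) : inner 𝕜 x (F.starProjection y) = 4⁻¹ * inner 𝕜 x y := by
  conv_rhs => rw [← h.four_smul_starProjection hy]
  rw [inner_smul_right, ← inner_starProjection_left_eq_right E,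
    starProjection_eq_self_iff.2 hx, inv_mul_cancel_left₀ (by norm_num)]

theorem inner_add_add (h : ProjBraid E F) {k k' v v' w w' : H} (hk : k ∈ E ⊓ F)
    (hk' : k' ∈ E ⊓ F) (hv : v ∈ (E ⊓ F)ᗮ ⊓ E) (hv' : v' ∈ (E ⊓ F)ᗮ ⊓ E)
    (hw : w ∈ (E ⊓ F)ᗮ ⊓ E) (hw' : w' ∈ (E ⊓ F)ᗮ ⊓ E) :
    inner 𝕜 (k + (v + F.starProjection w)) (k' + (v' + F.starProjection w')) =
      inner 𝕜 k k' + inner 𝕜 v v' +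
        4⁻¹ * (inner 𝕜 w w' + inner 𝕜 v w' + inner 𝕜 w v') := by
  have hl {k v : H} (hk : k ∈ E ⊓ F) (hv : v ∈ (E ⊓ F)ᗮ ⊓ E) : inner 𝕜 k v = 0 :=
    (mem_orthogonal _ _).1 hv.1 k hk
  have hr {k v : H} (hk : k ∈ E ⊓ F) (hv : v ∈ (E ⊓ F)ᗮ ⊓ E) : inner 𝕜 v k = 0 :=
    inner_eq_zero_symm.1 (hl hk hv)
  have hF {k : H} (hk : k ∈ E ⊓ F) : F.starProjection k = k := starProjection_eq_self_iff.2 hk.2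
  have hQQ (y : H) : F.starProjection (F.starProjection y) = F.starProjection y :=
    starProjection_eq_self_iff.2 (starProjection_apply_mem F y)
  have h1 : inner 𝕜 k (F.starProjection w') = 0 := by
    rw [← inner_starProjection_left_eq_right, hF hk, hl hk hw']
  simp only [inner_add_left, inner_add_right, inner_starProjection_left_eq_right, hQQ, h1, hF hk',
    hl hk hv', hr hk' hv, hr hk' hw, h.inner_starProjection hv.2 hw',
    h.inner_starProjection hw.2 hv', h.inner_starProjection hw.2 hw']
  ring

/-- Pairs of subspaces whose reflections satisfy the braid relation are classified up to isometry
by their dimensions and the dimension of their intersection. -/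
theorem exists_linearIsometryEquiv {E' F' : Submodule 𝕜 H} (h : ProjBraid E F)
    (h' : ProjBraid E' F') (hE : Module.finrank 𝕜 E = Module.finrank 𝕜 E')
    (hF : Module.finrank 𝕜 F = Module.finrank 𝕜 F')
    (hEF : Module.finrank 𝕜 ↥(E ⊓ F) = Module.finrank 𝕜 ↥(E' ⊓ F')) :
    ∃ U : H ≃ₗᵢ[𝕜] H, E.map (U.toLinearEquiv : H →ₗ[𝕜] H) = E' ∧
      F.map (U.toLinearEquiv : H →ₗ[𝕜] H) = F' := by
  obtain ⟨S⟩ := nonempty_linearIsometryEquiv_of_finrank_eq hEF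
  obtain ⟨T⟩ := nonempty_linearIsometryEquiv_of_finrank_eq (𝕜 := 𝕜)
    (K := (E ⊓ F)ᗮ ⊓ E) (L := (E' ⊓ F')ᗮ ⊓ E') (by
      have h1 := finrank_add_inf_finrank_orthogonal (𝕜 := 𝕜) (inf_le_left : E ⊓ F ≤ E)
      have h2 := finrank_add_inf_finrank_orthogonal (𝕜 := 𝕜) (inf_le_left : E' ⊓ F' ≤ E')
      omega)
  obtain ⟨U, hU⟩ := exists_linearIsometryEquiv_of_inner_eq
    ((E ⊓ F).subtype.coprod (((E ⊓ F)ᗮ ⊓ E).subtype.coprod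
      ((F.starProjection : H →ₗ[𝕜] H) ∘ₗ ((E ⊓ F)ᗮ ⊓ E).subtype)))
    (((E' ⊓ F').subtype ∘ₗ S.toLinearEquiv.toLinearMap).coprod
      ((((E' ⊓ F')ᗮ ⊓ E').subtype ∘ₗ T.toLinearEquiv.toLinearMap).coprod
      ((F'.starProjection : H →ₗ[𝕜] H) ∘ₗ ((E' ⊓ F')ᗮ ⊓ E').subtype ∘ₗ
        T.toLinearEquiv.toLinearMap))) (by
      rintro ⟨k, v, w⟩ ⟨k', v', w'⟩
      have h1 := h.inner_add_add k.2 k'.2 v.2 v'.2 w.2 w'.2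
      have h2 := h'.inner_add_add (S k).2 (S k').2 (T v).2 (T v').2 (T w).2 (T w').2
      simp only [← coe_inner, LinearIsometryEquiv.inner_map_map] at h1 h2
      exact h1.trans h2.symm)
  have hUK {k : H} (hk : k ∈ E ⊓ F) : U k = S ⟨k, hk⟩ := by
    simpa using hU (⟨k, hk⟩, 0, 0)
  have hUV {v : H} (hv : v ∈ (E ⊓ F)ᗮ ⊓ E) : U v = T ⟨v, hv⟩ := by
    simpa using hU (0, ⟨v, hv⟩, 0)
  have hUF {v : H} (hv : v ∈ (E ⊓ F)ᗮ ⊓ E) :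
      U (F.starProjection v) = F'.starProjection (T ⟨v, hv⟩) := by
    simpa using hU (0, 0, ⟨v, hv⟩)
  refine ⟨U, eq_of_le_of_finrank_eq ?_ (by rw [LinearEquiv.finrank_map_eq, hE]),
    eq_of_le_of_finrank_eq ?_ (by rw [LinearEquiv.finrank_map_eq, hF])⟩
  · rw [map_le_iff_le_comap]
    conv_lhs => rw [← sup_orthogonal_inf_of_hasOrthogonalProjection (inf_le_left : E ⊓ F ≤ E)]
    refine sup_le (fun k hk => ?_) (fun v hv => ?_)
    · change U k ∈ E'
      exact hUK hk ▸ (S ⟨k, hk⟩).2.1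
    · change U v ∈ E'
      exact hUV hv ▸ (T ⟨v, hv⟩).2.2
  · rw [map_le_iff_le_comap]
    conv_lhs => rw [← sup_orthogonal_inf_of_hasOrthogonalProjection (inf_le_right : E ⊓ F ≤ F)]
    refine sup_le (fun k hk => ?_) (fun y hy => ?_)
    · change U k ∈ F'
      exact hUK hk ▸ (S ⟨k, hk⟩).2.2
    · change U y ∈ F'
      have hy4 := h.symm.four_smul_starProjection (x := y) (by rwa [inf_comm F E])
      have hPy : E.starProjection y ∈ (E ⊓ F)ᗮ ⊓ E := by
        refine ⟨(mem_orthogonal _ _).2 fun k hk => ?_, starProjection_apply_mem E y⟩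
        rw [← inner_starProjection_left_eq_right, starProjection_eq_self_iff.2 hk.1]
        exact (mem_orthogonal _ _).1 hy.1 k hk
      rw [← hy4, map_smul, hUF hPy]
      exact F'.smul_mem _ (starProjection_apply_mem F' _)

end ProjBraid

end Subspaces

section Matrices

open Submodule

theorem Matrix.inv_eq_star_of_mem_unitaryGroup {n : Type*} [Fintype n] [DecidableEq n]
    {U : Matrix n n ℂ} (hU : U ∈ Matrix.unitaryGroup n ℂ) : U⁻¹ = star U :=
  Matrix.inv_eq_right_inv (Matrix.mem_unitaryGroup_iff.1 hU)

variable {N a : ℕ}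

theorem mem_eigSp_iff {M : Matrix (Fin N) (Fin N) ℂ} {x : EuclideanSpace ℂ (Fin N)} :
    x ∈ eigSp N a M ↔ Matrix.toEuclideanCLM (𝕜 := ℂ) M x =
      -(Complex.exp (a * Real.pi * Complex.I / N)) • x := by
  rw [eigSp, Module.End.mem_eigenspace_iff, ← Matrix.coe_toEuclideanCLM_eq_toEuclideanLin]
  rfl

theorem exists_isStarProjection_of_mem_conjClass {M : Matrix (Fin N) (Fin N) ℂ}
    (hM : M ∈ conjClass N a) : ∃ P : Matrix (Fin N) (Fin N) ℂ, IsStarProjection P ∧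
      M = Complex.exp (a * Real.pi * Complex.I / N) • (1 - (2 : ℂ) • P) := by
  obtain ⟨U, hU, rfl⟩ := hM
  have hU' := (Matrix.mem_specialUnitaryGroup_iff.1 hU).1
  have h1 : star U * U = 1 := Matrix.mem_unitaryGroup_iff'.1 hU'
  have h2 : U * star U = 1 := Matrix.mem_unitaryGroup_iff.1 hU'
  rw [Matrix.inv_eq_star_of_mem_unitaryGroup hU']
  set D : Matrix (Fin N) (Fin N) ℂ :=
    Matrix.diagonal fun i : Fin N => if (i : ℕ) < a then (1 : ℂ) else 0 with hD
  have hDD : D * D = D := by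
    rw [hD, Matrix.diagonal_mul_diagonal]
    simp
  have hDs : star D = D := by
    rw [hD, Matrix.star_eq_conjTranspose, Matrix.diagonal_conjTranspose]
    congr 1
    ext i
    by_cases h : (i : ℕ) < a <;> simp [h]
  refine ⟨U * D * star U, ⟨?_, ?_⟩, ?_⟩
  · change U * D * star U * (U * D * star U) = U * D * star U
    calc U * D * star U * (U * D * star U) = U * D * (star U * U) * D * star U := by
          simp only [mul_assoc]
      _ = U * D * star U := by rw [h1, mul_one, mul_assoc U D D, hDD]
  · simp [isSelfAdjoint_iff, hDs, mul_assoc]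
  · have hPhi : Phi N a = Complex.exp (a * Real.pi * Complex.I / N) • (1 - (2 : ℂ) • D) := by
      rw [Phi, hD, ← Matrix.diagonal_one, ← Matrix.diagonal_smul (2 : ℂ), Matrix.diagonal_sub]
      congr 2
      ext i
      by_cases h : (i : ℕ) < a <;> simp [h]
      norm_num
    rw [hPhi, mul_smul_comm, smul_mul_assoc, mul_sub, sub_mul, mul_one, h2, mul_smul_comm,
      smul_mul_assoc]

theorem toEuclideanCLM_eq_of_mem_conjClass {M : Matrix (Fin N) (Fin N) ℂ}
    (hM : M ∈ conjClass N a) : Matrix.toEuclideanCLM (𝕜 := ℂ) M =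
      Complex.exp (a * Real.pi * Complex.I / N) •
        (1 - (2 : ℂ) • (eigSp N a M).starProjection) := by
  obtain ⟨P, hP, hMP⟩ := exists_isStarProjection_of_mem_conjClass hM
  obtain ⟨E, _, hE⟩ := isStarProjection_iff_eq_starProjection.1
    (hP.map (Matrix.toEuclideanCLM (𝕜 := ℂ) (n := Fin N)))
  have hf : Matrix.toEuclideanCLM (𝕜 := ℂ) M =
      Complex.exp (a * Real.pi * Complex.I / N) • (1 - (2 : ℂ) • E.starProjection) := by
    rw [hMP, map_smul, map_sub, map_one, map_smul, hE]
  have hEM : eigSp N a M = E := by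
    ext x
    rw [mem_eigSp_iff, hf, ← starProjection_eq_self_iff (K := E), neg_smul, ← smul_neg]
    change Complex.exp (a * Real.pi * Complex.I / N) • (x - (2 : ℂ) • E.starProjection x) = _ ↔ _
    rw [smul_right_inj (Complex.exp_ne_zero _)]
    constructor
    · intro h
      have h2 : (2 : ℂ) • (E.starProjection x - x) = 0 := by
        linear_combination (norm := module) -h
      exact sub_eq_zero.1 ((smul_eq_zero.1 h2).resolve_left two_ne_zero)
    · intro h
      rw [h]
      module
  subst hEM
  exact hf

theorem projBraid_of_braid {A B : Matrix (Fin N) (Fin N) ℂ} (hA : A ∈ conjClass N a)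
    (hB : B ∈ conjClass N a) (h : A * B * A = B * A * B) :
    ProjBraid (eigSp N a A) (eigSp N a B) := by
  have hf := congrArg (Matrix.toEuclideanCLM (𝕜 := ℂ) (n := Fin N)) h
  simp only [map_mul, toEuclideanCLM_eq_of_mem_conjClass hA,
    toEuclideanCLM_eq_of_mem_conjClass hB] at hf
  simp only [smul_mul_assoc, mul_smul_comm] at hf
  have hc := smul_right_injective (EuclideanSpace ℂ (Fin N) →L[ℂ] EuclideanSpace ℂ (Fin N))
    (Complex.exp_ne_zero (a * Real.pi * Complex.I / N))
  replace hf := hc (hc (hc hf))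
  intro x
  have hx := DFunLike.congr_fun hf x
  have hPP (y) : (eigSp N a A).starProjection ((eigSp N a A).starProjection y) =
      (eigSp N a A).starProjection y :=
    starProjection_eq_self_iff.2 (starProjection_apply_mem _ y)
  have hQQ (y) : (eigSp N a B).starProjection ((eigSp N a B).starProjection y) =
      (eigSp N a B).starProjection y :=
    starProjection_eq_self_iff.2 (starProjection_apply_mem _ y)
  simp only [mul_apply_eq_comp, sub_apply, smul_apply, one_apply_eq_self, map_sub, map_smul,
    hPP, hQQ] at hx
  linear_combination (norm := module) (-(1 / 2 : ℂ)) • hx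

theorem eigSp_conj {U : Matrix (Fin N) (Fin N) ℂ} (hU : U ∈ Matrix.unitaryGroup (Fin N) ℂ)
    (M : Matrix (Fin N) (Fin N) ℂ) : eigSp N a (U * M * U⁻¹) =
      (eigSp N a M).map ((Unitary.linearIsometryEquiv ⟨Matrix.toEuclideanCLM (𝕜 := ℂ) U,
        Unitary.map_mem (Matrix.toEuclideanCLM (𝕜 := ℂ) (n := Fin N)) hU⟩).toLinearEquiv :
        EuclideanSpace ℂ (Fin N) →ₗ[ℂ] EuclideanSpace ℂ (Fin N)) := by
  set e := Unitary.linearIsometryEquiv ⟨Matrix.toEuclideanCLM (𝕜 := ℂ) U,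
        Unitary.map_mem (Matrix.toEuclideanCLM (𝕜 := ℂ) (n := Fin N)) hU⟩
  have h1 : star U * U = 1 := Matrix.mem_unitaryGroup_iff'.1 hU
  have hUU (x) : Matrix.toEuclideanCLM (𝕜 := ℂ) (star U) (Matrix.toEuclideanCLM (𝕜 := ℂ) U x) =
      x := by
    rw [← mul_apply_eq_comp, ← map_mul, h1, map_one, one_apply_eq_self]
  ext y
  obtain ⟨x, rfl⟩ := e.surjective y
  have hx : e x ∈ (eigSp N a M).map (e.toLinearEquiv :
      EuclideanSpace ℂ (Fin N) →ₗ[ℂ] EuclideanSpace ℂ (Fin N)) ↔ x ∈ eigSp N a M :=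
    e.injective.mem_set_image
  rw [hx, mem_eigSp_iff, mem_eigSp_iff, Matrix.inv_eq_star_of_mem_unitaryGroup hU]
  change Matrix.toEuclideanCLM (𝕜 := ℂ) (U * M * star U) (Matrix.toEuclideanCLM (𝕜 := ℂ) U x) =
    _ • e x ↔ _
  rw [map_mul, map_mul, mul_apply_eq_comp, mul_apply_eq_comp, hUU,
    ← map_smul]
  exact e.injective.eq_iff

theorem finrank_eigSp_inf_conj {U : Matrix (Fin N) (Fin N) ℂ}
    (hU : U ∈ Matrix.unitaryGroup (Fin N) ℂ) (A B : Matrix (Fin N) (Fin N) ℂ) :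
    Module.finrank ℂ ↥(eigSp N a (U * A * U⁻¹) ⊓ eigSp N a (U * B * U⁻¹)) =
      Module.finrank ℂ ↥(eigSp N a A ⊓ eigSp N a B) := by
  rw [eigSp_conj hU, eigSp_conj hU, ← Submodule.map_inf _ (LinearEquiv.injective _),
    LinearEquiv.finrank_map_eq]

theorem finrank_eigSp_eq {A B : Matrix (Fin N) (Fin N) ℂ} (hA : A ∈ conjClass N a)
    (hB : B ∈ conjClass N a) :
    Module.finrank ℂ (eigSp N a A) = Module.finrank ℂ (eigSp N a B) := by
  have key {M} (hM : M ∈ conjClass N a) :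
      Module.finrank ℂ (eigSp N a M) = Module.finrank ℂ (eigSp N a (Phi N a)) := by
    obtain ⟨U, hU, rfl⟩ := hM
    rw [eigSp_conj (Matrix.mem_specialUnitaryGroup_iff.1 hU).1, LinearEquiv.finrank_map_eq]
  rw [key hA, key hB]

/-- A unitary matrix carrying the eigenspace of `A` to that of `B` conjugates `A` to `B`. -/
theorem eq_conj_of_map_eigSp_eq {A B U : Matrix (Fin N) (Fin N) ℂ} (hA : A ∈ conjClass N a)
    (hB : B ∈ conjClass N a) (hU : U ∈ Matrix.unitaryGroup (Fin N) ℂ)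
    (e : EuclideanSpace ℂ (Fin N) ≃ₗᵢ[ℂ] EuclideanSpace ℂ (Fin N))
    (he : ∀ x, Matrix.toEuclideanCLM (𝕜 := ℂ) U x = e x)
    (h : (eigSp N a A).map (e.toLinearEquiv :
      EuclideanSpace ℂ (Fin N) →ₗ[ℂ] EuclideanSpace ℂ (Fin N)) = eigSp N a B) :
    B = U * A * U⁻¹ := by
  have h2 : U * star U = 1 := Matrix.mem_unitaryGroup_iff.1 hU
  have hBU : B * U = U * A := by
    apply EquivLike.injective (Matrix.toEuclideanCLM (𝕜 := ℂ) (n := Fin N))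
    ext1 x
    rw [map_mul, map_mul, mul_apply_eq_comp, mul_apply_eq_comp, he, he,
      toEuclideanCLM_eq_of_mem_conjClass hA, toEuclideanCLM_eq_of_mem_conjClass hB]
    have hp := starProjection_map_apply e (eigSp N a A) (e x)
    simp only [h, LinearIsometryEquiv.symm_apply_apply] at hp
    simp [hp]
  rw [Matrix.inv_eq_star_of_mem_unitaryGroup hU, ← hBU, mul_assoc, h2, mul_one]

end Matrices

/-- Two pairs in `C_a × C_a` satisfying the braid relation are simultaneously conjugate by a
unitary matrix if and only if their eigenspace-intersection dimensions agree. -/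
theorem stmt2 (N a : ℕ) (hN : 0 < N) (ha : a ≤ N)
    (MA MB MA' MB' : Matrix (Fin N) (Fin N) ℂ)
    (hA : MA ∈ conjClass N a) (hB : MB ∈ conjClass N a)
    (hA' : MA' ∈ conjClass N a) (hB' : MB' ∈ conjClass N a)
    (hbr : MA * MB * MA = MB * MA * MB)
    (hbr' : MA' * MB' * MA' = MB' * MA' * MB') :
    (∃ U ∈ Matrix.unitaryGroup (Fin N) ℂ, MA' = U * MA * U⁻¹ ∧ MB' = U * MB * U⁻¹) ↔
      Module.finrank ℂ ↥(eigSp N a MA ⊓ eigSp N a MB) =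
        Module.finrank ℂ ↥(eigSp N a MA' ⊓ eigSp N a MB') := by
  constructor
  · rintro ⟨U, hU, rfl, rfl⟩
    exact (finrank_eigSp_inf_conj hU MA MB).symm
  · intro hdim
    obtain ⟨e, heA, heB⟩ := (projBraid_of_braid hA hB hbr).exists_linearIsometryEquiv
      (projBraid_of_braid hA' hB' hbr') (finrank_eigSp_eq hA hA') (finrank_eigSp_eq hB hB') hdim
    obtain ⟨U, hUe⟩ := EquivLike.surjective (Matrix.toEuclideanCLM (𝕜 := ℂ) (n := Fin N))
      (Unitary.linearIsometryEquiv.symm e : EuclideanSpace ℂ (Fin N) →L[ℂ] _)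
    have hU : U ∈ Matrix.unitaryGroup (Fin N) ℂ := by
      rw [Matrix.mem_unitaryGroup_iff']
      apply EquivLike.injective (Matrix.toEuclideanCLM (𝕜 := ℂ) (n := Fin N))
      rw [map_mul, map_star, hUe, map_one]
      exact Unitary.coe_star_mul_self _
    have he (x) : Matrix.toEuclideanCLM (𝕜 := ℂ) U x = e x := by
      rw [hUe]
      rfl
    exact ⟨U, hU, eq_conj_of_map_eigSp_eq hA hA' hU e he heA,
      eq_conj_of_map_eigSp_eq hB hB' hU e he heB⟩
end

section
/- Let 0 ≤ l ≤ a be integers with 2a − l ≤ N. In ℂ^N with standard orthonormal basis e₁, …, e_N, let Λ_A = span{e₁, …, e_a} and let Λ_B = span({e₁, …, e_l} ∪ {e_{l+i} + √3·e_{a+i} : 1 ≤ i ≤ a − l}). Then a unitary matrix T ∈ U(N) satisfies T(Λ_A) = Λ_A and T(Λ_B) = Λ_B if and only if T is block diagonal of the form diag(U, V, V, W) with blocks of sizes l, a − l, a − l, N − 2a + l, where U ∈ U(l), W ∈ U(N − 2a + l), and the two middle blocks are equal to the same matrix V ∈ U(a − l). -/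
open Matrix in
/-- The restriction of a unitary matrix to an invariant block of coordinates is unitary. -/
theorem Matrix.submatrix_mem_unitaryGroup {m n : Type*} [Fintype m] [DecidableEq m] [Fintype n]
    [DecidableEq n] {T : Matrix n n ℂ} (hT : T ∈ unitaryGroup n ℂ) (f : m → n)
    (hf : Function.Injective f) (h : ∀ i j, j ∉ Set.range f → T (f i) j = 0) :
    T.submatrix f f ∈ unitaryGroup m ℂ := by
  rw [mem_unitaryGroup_iff] at hT ⊢
  ext i j
  have key := congrFun (congrFun hT (f i)) (f j)
  rw [mul_apply] at key ⊢
  have h1 : (1 : Matrix m m ℂ) i j = (1 : Matrix n n ℂ) (f i) (f j) := by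
    simp [one_apply, hf.eq_iff]
  rw [h1, ← key]
  refine Fintype.sum_of_injective f hf _ _ (fun k hk => ?_) fun k => rfl
  rw [h i k hk, zero_mul]

/-- A vector supported on a set of coordinates lies in any subspace containing the corresponding
standard basis vectors. -/
theorem EuclideanSpace.mem_of_single_mem {n : Type*} [Fintype n] [DecidableEq n]
    (L : Submodule ℂ (EuclideanSpace ℂ n)) (v : EuclideanSpace ℂ n)
    (h : ∀ i, v i ≠ 0 → EuclideanSpace.single i (1 : ℂ) ∈ L) : v ∈ L := by
  have hv : v = ∑ i, v i • EuclideanSpace.single i (1 : ℂ) := by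
    ext j
    simp [Pi.single_apply]
  rw [hv]
  refine L.sum_mem fun i _ => ?_
  by_cases hi : v i = 0
  · simp [hi]
  · exact L.smul_mem _ (h i hi)

/-- Membership in the span of some standard basis vectors and of the vectors `e_{p k} + c e_{q k}`,
in terms of coordinates. -/
theorem EuclideanSpace.mem_of_single_add_smul_single_mem {m n : Type*} [Fintype m] [DecidableEq m]
    [Fintype n] [DecidableEq n] (L : Submodule ℂ (EuclideanSpace ℂ n)) (c : ℂ) (p q : m → n)
    (hp : Function.Injective p) (hq : Function.Injective q) (hpq : ∀ i j, p i ≠ q j)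
    (hL : ∀ k, EuclideanSpace.single (p k) (1 : ℂ) + c • EuclideanSpace.single (q k) (1 : ℂ) ∈ L)
    (v : EuclideanSpace ℂ n) (hv : ∀ k, v (q k) = c * v (p k))
    (h : ∀ i, v i ≠ 0 → i ∉ Set.range p → i ∉ Set.range q →
      EuclideanSpace.single i (1 : ℂ) ∈ L) : v ∈ L := by
  set w : EuclideanSpace ℂ n := ∑ k, v (p k) •
    (EuclideanSpace.single (p k) (1 : ℂ) + c • EuclideanSpace.single (q k) (1 : ℂ)) with hw
  have hwL : w ∈ L := L.sum_mem fun k _ => L.smul_mem _ (hL k)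
  have hwi : ∀ i, w i = ∑ k, v (p k) * ((if i = p k then 1 else 0) +
      c * (if i = q k then 1 else 0)) := by
    intro i
    simp [hw, Pi.single_apply, mul_add]
  have hwp : ∀ k, w (p k) = v (p k) := by
    intro k
    simp [hwi, hp.eq_iff, hpq]
  have hwq : ∀ k, w (q k) = v (q k) := by
    intro k
    simp [hwi, hq.eq_iff, fun i j => (hpq i j).symm, hv, mul_comm]
  have hsub : v - w ∈ L := by
    refine mem_of_single_mem L _ fun i hi => ?_
    have hip : i ∉ Set.range p := by
      rintro ⟨k, rfl⟩
      simp [hwp] at hi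
    have hiq : i ∉ Set.range q := by
      rintro ⟨k, rfl⟩
      simp [hwq] at hi
    refine h i (fun h0 => hi ?_) hip hiq
    have : w i = 0 := by
      rw [hwi]
      refine Finset.sum_eq_zero fun k _ => ?_
      rw [if_neg fun e => hip ⟨k, e.symm⟩, if_neg fun e => hiq ⟨k, e.symm⟩]
      simp
    simp [h0, this]
  simpa using L.add_mem hsub hwL

theorem Matrix.toEuclideanLin_single_apply {n : Type*} [Fintype n] [DecidableEq n]
    (T : Matrix n n ℂ) (i j : n) :
    toEuclideanLin T (EuclideanSpace.single j (1 : ℂ)) i = T i j := by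
  simp [toLpLin_apply]

theorem Matrix.toEuclideanLin_star_mul_self_apply {n : Type*} [Fintype n] [DecidableEq n]
    {T : Matrix n n ℂ} (hT : T ∈ unitaryGroup n ℂ) (v : EuclideanSpace ℂ n) :
    toEuclideanLin (star T) (toEuclideanLin T v) = v := by
  rw [mem_unitaryGroup_iff'] at hT
  simp [toLpLin_apply, hT]

/-- The adjoint of a unitary matrix preserves every subspace preserved by the matrix. -/
theorem Matrix.toEuclideanLin_star_mem {n : Type*} [Fintype n] [DecidableEq n]
    {T : Matrix n n ℂ} (hT : T ∈ unitaryGroup n ℂ) {L : Submodule ℂ (EuclideanSpace ℂ n)}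
    (h : L.map (toEuclideanLin T) = L) {v : EuclideanSpace ℂ n} (hv : v ∈ L) :
    toEuclideanLin (star T) v ∈ L := by
  rw [← h] at hv
  obtain ⟨w, hw, rfl⟩ := hv
  rwa [toEuclideanLin_star_mul_self_apply hT]

theorem Matrix.map_toEuclideanLin_eq_of_le {n : Type*} [Fintype n] [DecidableEq n]
    {T : Matrix n n ℂ} (hT : T ∈ unitaryGroup n ℂ) {L : Submodule ℂ (EuclideanSpace ℂ n)}
    (h : L.map (toEuclideanLin T) ≤ L) : L.map (toEuclideanLin T) = L := by
  refine Submodule.eq_of_le_of_finrank_eq h ?_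
  exact (Submodule.equivMapOfInjective _
    (Function.LeftInverse.injective (toEuclideanLin_star_mul_self_apply hT)) L).finrank_eq.symm

/-- Vanishing and coincidence of the entries of a matrix preserving the two model subspaces. -/
theorem entries_of_map_le {N a l : ℕ} (hl : l ≤ a) (hN : a + (a - l) ≤ N)
    (T : Matrix (Fin N) (Fin N) ℂ)
    (LA LB : Submodule ℂ (EuclideanSpace ℂ (Fin N)))
    (hLA : LA = Submodule.span ℂ
      {v | ∃ i : Fin N, (i : ℕ) < a ∧ v = EuclideanSpace.single i (1 : ℂ)})
    (hLB : LB = Submodule.span ℂ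
      ({v | ∃ i : Fin N, (i : ℕ) < l ∧ v = EuclideanSpace.single i (1 : ℂ)} ∪
       {v | ∃ i : ℕ, ∃ hi : i < a - l,
          v = EuclideanSpace.single (⟨l + i, by omega⟩ : Fin N) (1 : ℂ) +
              (Real.sqrt 3 : ℂ) • EuclideanSpace.single (⟨a + i, by omega⟩ : Fin N) (1 : ℂ)}))
    (hA : ∀ v ∈ LA, Matrix.toEuclideanLin T v ∈ LA)
    (hB : ∀ v ∈ LB, Matrix.toEuclideanLin T v ∈ LB) :
    (∀ i j : Fin N, a ≤ (i : ℕ) → (j : ℕ) < a → T i j = 0) ∧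
    (∀ i j : Fin N, l ≤ (i : ℕ) → (j : ℕ) < l → T i j = 0) ∧
    ((∀ i j : Fin N, (i : ℕ) < a → a ≤ (j : ℕ) → T i j = 0) →
      (∀ i j : Fin N, 2 * a - l ≤ (i : ℕ) → (j : ℕ) < 2 * a - l → T i j = 0) ∧
      ∀ (i j : ℕ) (hi : i < a - l) (hj : j < a - l),
        T ⟨a + i, by omega⟩ ⟨a + j, by omega⟩ = T ⟨l + i, by omega⟩ ⟨l + j, by omega⟩) := by
  have h3 : (Real.sqrt 3 : ℂ) ≠ 0 := by
    simp
  have memA : ∀ v ∈ LA, ∀ i : Fin N, a ≤ (i : ℕ) → v i = 0 := by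
    intro v hv i hi
    rw [hLA] at hv
    induction hv using Submodule.span_induction with
    | mem x hx =>
      obtain ⟨j, hj, rfl⟩ := hx
      have : i ≠ j := by rintro rfl; omega
      simp [this]
    | zero => simp
    | add x y _ _ hx hy => simp [hx, hy]
    | smul c x _ hx => simp [hx]
  have memB : ∀ v ∈ LB, (∀ i : Fin N, 2 * a - l ≤ (i : ℕ) → v i = 0) ∧
      ∀ (i : ℕ) (hi : i < a - l), v ⟨a + i, by omega⟩ = Real.sqrt 3 * v ⟨l + i, by omega⟩ := by
    intro v hv
    rw [hLB] at hv
    induction hv using Submodule.span_induction with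
    | mem x hx =>
      rcases hx with ⟨j, hj, rfl⟩ | ⟨j, hj, rfl⟩
      · refine ⟨fun i hi => ?_, fun i hi => ?_⟩
        · simp only [PiLp.single_apply, Fin.ext_iff]
          rw [if_neg (by omega)]
        · simp only [PiLp.single_apply, Fin.ext_iff]
          rw [if_neg (by omega), if_neg (by omega), mul_zero]
      · refine ⟨fun i hi => ?_, fun i hi => ?_⟩
        · simp only [PiLp.add_apply, PiLp.smul_apply, PiLp.single_apply, Fin.ext_iff]
          rw [if_neg (by omega), if_neg (by omega)]
          simp
        · simp only [PiLp.add_apply, PiLp.smul_apply, PiLp.single_apply, Fin.ext_iff]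
          rw [if_neg (by omega : ¬ a + i = l + j), if_neg (by omega : ¬ l + i = a + j)]
          simp
    | zero => simp
    | add x y _ _ hx hy =>
      refine ⟨fun i hi => ?_, fun i hi => ?_⟩
      · simp [hx.1 i hi, hy.1 i hi]
      · simp [hx.2 i hi, hy.2 i hi, mul_add]
    | smul c x _ hx =>
      refine ⟨fun i hi => ?_, fun i hi => ?_⟩
      · simp [hx.1 i hi]
      · simp [hx.2 i hi, mul_left_comm]
  have genA : ∀ j : Fin N, (j : ℕ) < a → EuclideanSpace.single j (1 : ℂ) ∈ LA := fun j hj => by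
    rw [hLA]
    exact Submodule.subset_span ⟨j, hj, rfl⟩
  have genl : ∀ j : Fin N, (j : ℕ) < l → EuclideanSpace.single j (1 : ℂ) ∈ LB := fun j hj => by
    rw [hLB]
    exact Submodule.subset_span (Or.inl ⟨j, hj, rfl⟩)
  have genB : ∀ (k : ℕ) (hk : k < a - l),
      EuclideanSpace.single (⟨l + k, by omega⟩ : Fin N) (1 : ℂ) +
        (Real.sqrt 3 : ℂ) • EuclideanSpace.single (⟨a + k, by omega⟩ : Fin N) (1 : ℂ) ∈ LB :=
    fun k hk => by
      rw [hLB]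
      exact Submodule.subset_span (Or.inr ⟨k, hk, rfl⟩)
  have zA : ∀ i j : Fin N, a ≤ (i : ℕ) → (j : ℕ) < a → T i j = 0 := by
    intro i j hi hj
    have := memA _ (hA _ (genA j hj)) i hi
    rwa [Matrix.toEuclideanLin_single_apply] at this
  refine ⟨zA, fun i j hi hj => ?_, fun zA' => ?_⟩
  · by_cases hia : a ≤ (i : ℕ)
    · exact zA i j hia (by omega)
    have := (memB _ (hB _ (genl j hj))).2 (i - l)
      (by omega)
    simp only [Matrix.toEuclideanLin_single_apply] at this
    rw [zA _ _ (by simp) (by omega)] at this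
    have h := (mul_eq_zero.mp this.symm).resolve_left h3
    convert h
    omega
  · have gen := fun (k : ℕ) (hk : k < a - l) => memB _ (hB _ (genB k hk))
    simp only [map_add, map_smul, PiLp.add_apply, PiLp.smul_apply,
      Matrix.toEuclideanLin_single_apply, smul_eq_mul] at gen
    refine ⟨fun i j hi hj => ?_, fun i j hi hj => ?_⟩
    · by_cases hja : (j : ℕ) < a
      · exact zA i j (by omega) hja
      have := (gen (j - a) (by omega)).1 i hi
      rw [zA i _ (by omega) (by simp; omega), zero_add] at this
      have h := (mul_eq_zero.mp this).resolve_left h3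
      convert h
      omega
    · have := (gen j hj).2 i hi
      rw [zA _ _ (by simp) (by simp; omega),
        zA' ⟨l + i, by omega⟩ ⟨a + j, by omega⟩ (by simp; omega) (by simp)] at this
      simpa [h3] using this


/-- Stabilizer description for the model pair of subspaces of the trefoil representation space:
`T ∈ U(N)` preserves `Λ_A = span{e₁,…,e_a}` and
`Λ_B = span({e₁,…,e_l} ∪ {e_{l+i} + √3·e_{a+i} : 1 ≤ i ≤ a−l})` if and only if `T` is block
diagonal of the form `diag(U, V, V, W)` with `U ∈ U(l)`, `V ∈ U(a−l)`, `W ∈ U(N−2a+l)`. -/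
theorem stmt3 (N a l : ℕ) (hl : l ≤ a) (hN : 2 * a - l ≤ N)
    (T : Matrix (Fin N) (Fin N) ℂ) (hT : T ∈ Matrix.unitaryGroup (Fin N) ℂ)
    (LA LB : Submodule ℂ (EuclideanSpace ℂ (Fin N)))
    (hLA : LA = Submodule.span ℂ
      {v | ∃ i : Fin N, (i : ℕ) < a ∧ v = EuclideanSpace.single i (1 : ℂ)})
    (hLB : LB = Submodule.span ℂ
      ({v | ∃ i : Fin N, (i : ℕ) < l ∧ v = EuclideanSpace.single i (1 : ℂ)} ∪
       {v | ∃ i : ℕ, ∃ hi : i < a - l,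
          v = EuclideanSpace.single (⟨l + i, by omega⟩ : Fin N) (1 : ℂ) +
              (Real.sqrt 3 : ℂ) • EuclideanSpace.single (⟨a + i, by omega⟩ : Fin N) (1 : ℂ)})) :
    (Submodule.map (Matrix.toEuclideanLin T) LA = LA ∧
     Submodule.map (Matrix.toEuclideanLin T) LB = LB) ↔
    (∃ U ∈ Matrix.unitaryGroup (Fin l) ℂ,
     ∃ V ∈ Matrix.unitaryGroup (Fin (a - l)) ℂ,
     ∃ W ∈ Matrix.unitaryGroup (Fin (N - (2 * a - l))) ℂ,
      ∀ i j : Fin N, T i j =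
        if hi1 : (i : ℕ) < l then
          (if hj1 : (j : ℕ) < l then U ⟨i, hi1⟩ ⟨j, hj1⟩ else 0)
        else if hi2 : (i : ℕ) < a then
          (if hj2 : l ≤ (j : ℕ) ∧ (j : ℕ) < a then
            V ⟨(i : ℕ) - l, by omega⟩ ⟨(j : ℕ) - l, by omega⟩ else 0)
        else if hi3 : (i : ℕ) < 2 * a - l then
          (if hj3 : a ≤ (j : ℕ) ∧ (j : ℕ) < 2 * a - l then
            V ⟨(i : ℕ) - a, by omega⟩ ⟨(j : ℕ) - a, by omega⟩ else 0)
        else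
          (if hj4 : 2 * a - l ≤ (j : ℕ) then
            W ⟨(i : ℕ) - (2 * a - l), by have := i.isLt; omega⟩
              ⟨(j : ℕ) - (2 * a - l), by have := j.isLt; omega⟩ else 0)) := by
  constructor
  · rintro ⟨hA, hB⟩
    obtain ⟨zA, zl, hrest⟩ := entries_of_map_le hl (by omega) T LA LB hLA hLB
      (fun v hv => hA ▸ Submodule.mem_map_of_mem hv) (fun v hv => hB ▸ Submodule.mem_map_of_mem hv)
    obtain ⟨zA', zl', hrest'⟩ := entries_of_map_le hl (by omega) (star T) LA LB hLA hLB
      (fun v hv => Matrix.toEuclideanLin_star_mem hT hA hv)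
      (fun v hv => Matrix.toEuclideanLin_star_mem hT hB hv)
    simp only [Matrix.star_apply, star_eq_zero] at zA' zl' hrest'
    obtain ⟨zm, hV⟩ := hrest fun i j hi hj => zA' j i hj hi
    obtain ⟨zm', -⟩ := hrest' fun i j hi hj => zA j i hj hi
    refine ⟨T.submatrix (fun i => ⟨i, by omega⟩) (fun i => ⟨i, by omega⟩),
      Matrix.submatrix_mem_unitaryGroup hT _ (fun i j h => by simpa [Fin.ext_iff] using h) ?_,
      T.submatrix (fun i => ⟨l + i, by omega⟩) (fun i => ⟨l + i, by omega⟩),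
      Matrix.submatrix_mem_unitaryGroup hT _ (fun i j h => by simpa [Fin.ext_iff] using h) ?_,
      T.submatrix (fun i => ⟨2 * a - l + i, by omega⟩) (fun i => ⟨2 * a - l + i, by omega⟩),
      Matrix.submatrix_mem_unitaryGroup hT _ (fun i j h => by simpa [Fin.ext_iff] using h) ?_, ?_⟩
    · intro i j hj
      refine zl' j _ ?_ i.2
      by_contra! h
      exact hj ⟨⟨j, h⟩, rfl⟩
    · intro i j hj
      by_cases h1 : (j : ℕ) < l
      · exact zl _ j (by simp) h1
      by_cases h2 : a ≤ (j : ℕ)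
      · exact zA' j _ h2 (by simp; omega)
      exact absurd ⟨⟨j - l, by omega⟩, Fin.ext (by simp; omega)⟩ hj
    · intro i j hj
      refine zm _ j (by simp) ?_
      by_contra! h
      exact hj ⟨⟨j - (2 * a - l), by omega⟩, Fin.ext (by simp; omega)⟩
    · intro i j
      simp only [Matrix.submatrix_apply]
      split_ifs with hi1 hj1 hi2 hj2 hi3 hj3 hj4
      · rfl
      · exact zl' j i (by omega) hi1
      · congr 1 <;> ext <;> simp <;> omega
      · by_cases h1 : (j : ℕ) < l
        · exact zl i j (by omega) h1
        · exact zA' j i (by omega) hi2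
      · rw [← hV _ _ (by omega) (by omega)]
        congr 1 <;> ext <;> simp <;> omega
      · by_cases h1 : (j : ℕ) < a
        · exact zA i j (by omega) h1
        · exact zm' j i (by omega) hi3
      · congr 1 <;> ext <;> simp <;> omega
      · exact zm i j (by omega) (by omega)
  · rintro ⟨U, -, V, -, W, -, h⟩
    refine ⟨Matrix.map_toEuclideanLin_eq_of_le hT ?_, Matrix.map_toEuclideanLin_eq_of_le hT ?_⟩
    · nth_rw 1 [hLA]
      rw [Submodule.map_span_le]
      rintro _ ⟨j, hj, rfl⟩
      refine EuclideanSpace.mem_of_single_mem _ _ fun i hi => ?_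
      rw [Matrix.toEuclideanLin_single_apply, h] at hi
      have hia : (i : ℕ) < a := by
        by_contra hia
        rw [dif_neg (by omega), dif_neg hia] at hi
        split_ifs at hi <;> first | omega | exact hi rfl
      exact hLA ▸ Submodule.subset_span ⟨i, hia, rfl⟩
    · nth_rw 1 [hLB]
      rw [Submodule.map_span_le]
      intro v hv
      refine EuclideanSpace.mem_of_single_add_smul_single_mem LB (Real.sqrt 3 : ℂ)
        (fun k : Fin (a - l) => (⟨l + k, by omega⟩ : Fin N))
        (fun k : Fin (a - l) => (⟨a + k, by omega⟩ : Fin N))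
        (fun i j h => by simpa [Fin.ext_iff] using h) (fun i j h => by simpa [Fin.ext_iff] using h)
        (fun i j h => by simp [Fin.ext_iff] at h; omega)
        (fun k => by rw [hLB]; exact Submodule.subset_span (Or.inr ⟨k, k.2, rfl⟩)) _ (fun k => ?_)
        (fun i hi hip hiq => ?_)
      · rcases hv with ⟨j, hj, rfl⟩ | ⟨j, hj, rfl⟩
        · simp only [Matrix.toEuclideanLin_single_apply, h]
          rw [dif_neg (by omega), dif_neg (by omega), dif_pos (by omega), dif_neg (by omega),
            dif_neg (by omega), dif_pos (by omega), dif_neg (by omega), mul_zero]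
        · simp only [map_add, map_smul, PiLp.add_apply, PiLp.smul_apply,
            Matrix.toEuclideanLin_single_apply, smul_eq_mul, h]
          rw [dif_neg (by omega), dif_neg (by omega), dif_pos (by omega), dif_neg (by omega),
            dif_neg (by omega), dif_neg (by omega), dif_pos (by omega), dif_pos (by omega),
            dif_neg (by omega), dif_pos (by omega), dif_pos (by omega), dif_neg (by omega),
            dif_pos (by omega), dif_neg (by omega)]
          simp
      · have hil : (i : ℕ) < l := by
          by_contra hil
          have h1 : ¬ (i : ℕ) < a := fun h1 =>
            hip ⟨⟨i - l, by omega⟩, Fin.ext (by simp; omega)⟩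
          have h2 : ¬ (i : ℕ) < 2 * a - l := fun h2 =>
            hiq ⟨⟨i - a, by omega⟩, Fin.ext (by simp; omega)⟩
          have h0 : ∀ j : Fin N, (j : ℕ) < 2 * a - l → T i j = 0 := by
            intro j hj
            rw [h, dif_neg hil, dif_neg h1, dif_neg h2, dif_neg (by omega)]
          apply hi
          rcases hv with ⟨j, hj, rfl⟩ | ⟨j, hj, rfl⟩
          · rw [Matrix.toEuclideanLin_single_apply, h0 _ (by omega)]
          · simp only [map_add, map_smul, PiLp.add_apply, PiLp.smul_apply,
              Matrix.toEuclideanLin_single_apply]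
            rw [h0 _ (by simp; omega), h0 _ (by simp; omega)]
            simp
        rw [hLB]
        exact Submodule.subset_span (Or.inl ⟨i, hil, rfl⟩)
end

section
/- Let A and C be disjoint alphabets. For every integer i ≥ 1, the identity Σ_{j=1}^{i} (−1)^{j−1} · e_{i−j}(A) · ( Σ_{t=0}^{j} (−1)^t · h_{j−t}(A) · e_t(C) ) = e_i(A) − e_i(C) holds in the polynomial ring in the variables A ∪ C over any commutative ring. -/
open MvPolynomial

/-- The `k`-th elementary symmetric polynomial in the alphabet (finite set of variables) `A`. -/
noncomputable def esymF {σ : Type} [DecidableEq σ] (R : Type) [CommRing R]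
    (A : Finset σ) (k : ℕ) : MvPolynomial σ R :=
  ∑ t ∈ Finset.powersetCard k A, ∏ i ∈ t, X i

/-- The `k`-th complete homogeneous symmetric polynomial in the alphabet `A`. -/
noncomputable def hsymF {σ : Type} [DecidableEq σ] (R : Type) [CommRing R]
    (A : Finset σ) (k : ℕ) : MvPolynomial σ R :=
  ∑ m ∈ A.sym k, ((m : Multiset σ).map X).prod

theorem esymF_zero {σ : Type} [DecidableEq σ] (R : Type) [CommRing R] (A : Finset σ) :
    esymF R A 0 = 1 := by
  simp [esymF]

theorem hsymF_zero {σ : Type} [DecidableEq σ] (R : Type) [CommRing R] (A : Finset σ) :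
    hsymF R A 0 = 1 := by
  rw [hsymF, Finset.sym_zero, Finset.sum_singleton]
  exact Multiset.prod_zero

theorem esymF_insert_succ {σ : Type} [DecidableEq σ] (R : Type) [CommRing R]
    {A : Finset σ} {a : σ} (ha : a ∉ A) (n : ℕ) :
    esymF R (insert a A) (n + 1) = esymF R A (n + 1) + X a * esymF R A n := by
  unfold esymF
  have hmem : ∀ t ∈ Finset.powersetCard n A, a ∉ t := fun t ht h =>
    ha ((Finset.mem_powersetCard.1 ht).1 h)
  rw [Finset.powersetCard_succ_insert ha, Finset.sum_union, Finset.sum_image, Finset.mul_sum]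
  · congr 1
    exact Finset.sum_congr rfl fun t ht => Finset.prod_insert (hmem t ht)
  · intro s hs t ht h
    rw [← Finset.erase_insert (hmem s hs), ← Finset.erase_insert (hmem t ht), h]
  · refine Finset.disjoint_left.2 fun t ht ht' => ?_
    obtain ⟨s, -, rfl⟩ := Finset.mem_image.1 ht'
    exact ha ((Finset.mem_powersetCard.1 ht).1 (Finset.mem_insert_self a s))

theorem hsymF_insert_succ {σ : Type} [DecidableEq σ] (R : Type) [CommRing R]
    {A : Finset σ} {a : σ} (ha : a ∉ A) (n : ℕ) :
    hsymF R (insert a A) (n + 1) = hsymF R A (n + 1) + X a * hsymF R (insert a A) n := by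
  unfold hsymF
  rw [← Finset.sum_filter_not_add_sum_filter _ (fun m : Sym σ (n + 1) => a ∈ m), Finset.mul_sum]
  congr 1
  · refine Finset.sum_congr ?_ fun _ _ => rfl
    ext m
    simp only [Finset.mem_filter, Finset.mem_sym_iff, Finset.mem_insert]
    refine ⟨fun h b hb => (h.1 b hb).resolve_left ?_, fun h => ⟨fun b hb => .inr (h b hb), ?_⟩⟩
    · rintro rfl
      exact h.2 hb
    · exact fun hm => ha (h a hm)
  · symm
    refine Finset.sum_bij (fun m _ => a ::ₛ m) ?_ ?_ ?_ ?_
    · intro m hm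
      simp only [Finset.mem_filter, Finset.mem_sym_iff] at hm ⊢
      refine ⟨fun b hb => ?_, Sym.mem_cons_self a m⟩
      obtain rfl | hb := Sym.mem_cons.1 hb
      · exact Finset.mem_insert_self _ _
      · exact hm b hb
    · exact fun m _ m' _ h => Sym.cons_inj_right a m m' |>.1 h
    · intro m hm
      obtain ⟨hm, ham⟩ := Finset.mem_filter.1 hm
      obtain ⟨m', rfl⟩ := Sym.exists_cons_of_mem ham
      refine ⟨m', ?_, rfl⟩
      rw [Finset.mem_sym_iff] at hm ⊢
      exact fun b hb => hm b (Sym.mem_cons_of_mem hb)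
    · intro m _
      rw [Sym.coe_cons, Multiset.map_cons, Multiset.prod_cons]

/-- The generating series of the elementary symmetric polynomials, times the signed generating
series of the complete homogeneous ones, is `1`. -/
theorem mk_esymF_mul_mk_hsymF {σ : Type} [DecidableEq σ] (R : Type) [CommRing R]
    (A : Finset σ) :
    PowerSeries.mk (esymF R A) * PowerSeries.mk (fun n => (-1) ^ n * hsymF R A n) = 1 := by
  induction A using Finset.induction_on with
  | empty =>
    have he : PowerSeries.mk (esymF R (∅ : Finset σ)) = 1 := by
      ext1 n
      cases n with
      | zero => simp [esymF_zero]
      | succ n =>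
        rw [PowerSeries.coeff_mk, esymF, Finset.powersetCard_eq_empty.2 (by simp)]
        simp [PowerSeries.coeff_one]
    have hh : PowerSeries.mk (fun n => (-1) ^ n * hsymF R (∅ : Finset σ) n) = 1 := by
      ext1 n
      cases n with
      | zero => simp [hsymF_zero]
      | succ n => simp [hsymF, PowerSeries.coeff_one]
    rw [he, hh, one_mul]
  | insert a A ha ih =>
    have he : PowerSeries.mk (esymF R (insert a A)) =
        PowerSeries.mk (esymF R A) * (1 + PowerSeries.C (X a) * PowerSeries.X) := by
      ext1 n
      cases n with
      | zero => simp [esymF_zero]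
      | succ n =>
        rw [mul_add, mul_one, mul_left_comm, map_add, PowerSeries.coeff_C_mul,
          PowerSeries.coeff_succ_mul_X]
        simp [esymF_insert_succ R ha]
    have hh : (1 + PowerSeries.C (X a) * PowerSeries.X) *
        PowerSeries.mk (fun n => (-1) ^ n * hsymF R (insert a A) n) =
        PowerSeries.mk (fun n => (-1) ^ n * hsymF R A n) := by
      ext1 n
      cases n with
      | zero => simp [hsymF_zero]
      | succ n =>
        rw [add_mul, one_mul, mul_assoc, map_add, PowerSeries.coeff_C_mul,
          PowerSeries.coeff_succ_X_mul]
        simp only [PowerSeries.coeff_mk, hsymF_insert_succ R ha]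
        ring
    rw [he, mul_assoc, hh, ih]

/-- The supersymmetric convolution of `e(A)` with the signed `h(A)` and `e(C)` recovers `e(C)`. -/
theorem sum_esymF_mul_sum_hsymF_mul_esymF {σ : Type} [DecidableEq σ] (R : Type) [CommRing R]
    (A C : Finset σ) (i : ℕ) :
    ∑ j ∈ Finset.range (i + 1), (-1 : MvPolynomial σ R) ^ j * esymF R A (i - j) *
        (∑ t ∈ Finset.range (j + 1),
          (-1 : MvPolynomial σ R) ^ t * hsymF R A (j - t) * esymF R C t) = esymF R C i := by
  have h : PowerSeries.mk (esymF R C) * PowerSeries.mk (fun n => (-1) ^ n * hsymF R A n) *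
      PowerSeries.mk (esymF R A) = PowerSeries.mk (esymF R C) := by
    rw [mul_assoc, mul_comm (PowerSeries.mk fun n => (-1) ^ n * hsymF R A n), mk_esymF_mul_mk_hsymF, mul_one]
  have h' := congrArg (PowerSeries.coeff i) h
  simp only [PowerSeries.coeff_mul, PowerSeries.coeff_mk,
    Finset.Nat.sum_antidiagonal_eq_sum_range_succ_mk] at h'
  rw [← h']
  refine Finset.sum_congr rfl fun j _ => ?_
  rw [Finset.mul_sum, Finset.sum_mul]
  refine Finset.sum_congr rfl fun t ht => ?_
  obtain ⟨k, rfl⟩ := Nat.exists_eq_add_of_le (Finset.mem_range_succ_iff.1 ht)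
  have hsq : ((-1 : MvPolynomial σ R) ^ t) * (-1) ^ t = 1 := by
    rw [← mul_pow]
    simp
  rw [Nat.add_sub_cancel_left, pow_add]
  linear_combination ((-1) ^ k * esymF R A (i - (t + k)) * hsymF R A k * esymF R C t) * hsq

/-- For disjoint alphabets `A` and `C` and `i ≥ 1`:
`Σ_{j=1}^{i} (−1)^{j−1} e_{i−j}(A) (Σ_{t=0}^{j} (−1)^t h_{j−t}(A) e_t(C)) = e_i(A) − e_i(C)`. -/
theorem stmt12 {σ : Type} [DecidableEq σ] (R : Type) [CommRing R]
    (A C : Finset σ) (hAC : Disjoint A C) (i : ℕ) (hi : 1 ≤ i) :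
    ∑ j ∈ Finset.Icc 1 i,
        (-1 : MvPolynomial σ R) ^ (j - 1) * esymF R A (i - j) *
          (∑ t ∈ Finset.range (j + 1),
            (-1 : MvPolynomial σ R) ^ t * hsymF R A (j - t) * esymF R C t) =
      esymF R A i - esymF R C i := by
  have h := sum_esymF_mul_sum_hsymF_mul_esymF R A C i
  rw [Finset.range_eq_Ico, Finset.sum_eq_sum_Ico_succ_bot (Nat.succ_pos i)] at h
  simp only [zero_add, pow_zero, one_mul, Nat.sub_zero, Finset.sum_range_one, hsymF_zero,
    esymF_zero, mul_one] at h
  rw [← h, sub_add_cancel_left, ← Finset.sum_neg_distrib]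
  refine Finset.sum_congr rfl fun j hj => ?_
  obtain ⟨k, rfl⟩ := Nat.exists_eq_add_of_le' (Finset.mem_Icc.1 hj).1
  rw [Nat.add_sub_cancel, pow_succ]
  ring
end

section
/- Let A be a cochain complex of R-modules whose degree-n term decomposes as Aⁿ = A₀ⁿ ⊕ A₁ⁿ, with differential having components d_{0,0} : A₀ → A₀, d_{1,0} : A₀ → A₁, d_{1,1} : A₁ → A₁ (and zero component A₁ → A₀); so d∘d = 0 is equivalent to d_{0,0}² = 0, d_{1,1}² = 0, and d_{1,0} d_{0,0} + d_{1,1} d_{1,0} = 0. Suppose for i = 0, 1 there is a strong deformation retract (π_i, ι_i, h_i), satisfying the side conditions, of (A_i, d_{i,i}) onto a complex (Ā_i, d̄_i). Let Ā = Ā₀ ⊕ Ā₁ with differential having components d̄₀, d̄₁ and π₁ ∘ d_{1,0} ∘ ι₀ : Ā₀ → Ā₁. Then d̄ ∘ d̄ = 0, and the maps π : A → Ā with components π₀, π₁, and π₁ ∘ d_{1,0} ∘ h₀ : A₀ → Ā₁; ι : Ā → A with components ι₀, ι₁, and h₁ ∘ d_{1,0} ∘ ι₀ : Ā₀ → A₁;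 and h : A → A with components h₀, h₁, and h₁ ∘ d_{1,0} ∘ h₀ : A₀ → A₁, form a strong deformation retract of A onto Ā satisfying the side conditions. -/
/-- Homological perturbation for a complex split over the two-element poset `{0,1}` (i.e. a
mapping cone): if `A` has degree-`n` part `A₀ⁿ ⊕ A₁ⁿ` with differential components
`d₀₀, d₁₀, d₁₁`, and each `(Aᵢ, d_{i,i})` strongly deformation retracts (with side conditions)
onto `(Āᵢ, d̄ᵢ)`, then `Ā₀ ⊕ Ā₁` with differential components `d̄₀, d̄₁, π₁ ∘ d₁₀ ∘ ι₀` is a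
complex and the assembled maps `π, ι, h` (with mixed components `π₁ d₁₀ h₀`, `h₁ d₁₀ ι₀`,
`h₁ d₁₀ h₀`) form a strong deformation retract of `A` onto it, satisfying the side
conditions. -/
theorem stmt14 {R : Type} [CommRing R]
    (A₀ A₁ B₀ B₁ : ℤ → Type)
    [∀ n, AddCommGroup (A₀ n)] [∀ n, Module R (A₀ n)]
    [∀ n, AddCommGroup (A₁ n)] [∀ n, Module R (A₁ n)]
    [∀ n, AddCommGroup (B₀ n)] [∀ n, Module R (B₀ n)]
    [∀ n, AddCommGroup (B₁ n)] [∀ n, Module R (B₁ n)]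
    (d00 : ∀ n : ℤ, A₀ n →ₗ[R] A₀ (n + 1))
    (d10 : ∀ n : ℤ, A₀ n →ₗ[R] A₁ (n + 1))
    (d11 : ∀ n : ℤ, A₁ n →ₗ[R] A₁ (n + 1))
    (hd00 : ∀ n, d00 (n + 1) ∘ₗ d00 n = 0)
    (hd11 : ∀ n, d11 (n + 1) ∘ₗ d11 n = 0)
    (hd10 : ∀ n, d10 (n + 1) ∘ₗ d00 n + d11 (n + 1) ∘ₗ d10 n = 0)
    (dB0 : ∀ n : ℤ, B₀ n →ₗ[R] B₀ (n + 1)) (dB1 : ∀ n : ℤ, B₁ n →ₗ[R] B₁ (n + 1))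
    (hdB0 : ∀ n, dB0 (n + 1) ∘ₗ dB0 n = 0) (hdB1 : ∀ n, dB1 (n + 1) ∘ₗ dB1 n = 0)
    (π0 : ∀ n, A₀ n →ₗ[R] B₀ n) (ι0 : ∀ n, B₀ n →ₗ[R] A₀ n)
    (h0 : ∀ n : ℤ, A₀ (n + 1) →ₗ[R] A₀ n)
    (π1 : ∀ n, A₁ n →ₗ[R] B₁ n) (ι1 : ∀ n, B₁ n →ₗ[R] A₁ n)
    (h1 : ∀ n : ℤ, A₁ (n + 1) →ₗ[R] A₁ n)
    -- strong deformation retract of `(A₀, d₀₀)` onto `(B₀, d̄₀)`, with side conditions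
    (hπ0 : ∀ n, dB0 n ∘ₗ π0 n = π0 (n + 1) ∘ₗ d00 n)
    (hι0 : ∀ n, d00 n ∘ₗ ι0 n = ι0 (n + 1) ∘ₗ dB0 n)
    (hπι0 : ∀ n, π0 n ∘ₗ ι0 n = LinearMap.id)
    (hh0 : ∀ n, ι0 (n + 1) ∘ₗ π0 (n + 1) - LinearMap.id =
      d00 n ∘ₗ h0 n + h0 (n + 1) ∘ₗ d00 (n + 1))
    (hs01 : ∀ n, h0 n ∘ₗ ι0 (n + 1) = 0) (hs02 : ∀ n, π0 n ∘ₗ h0 n = 0)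
    (hs03 : ∀ n, h0 n ∘ₗ h0 (n + 1) = 0)
    -- strong deformation retract of `(A₁, d₁₁)` onto `(B₁, d̄₁)`, with side conditions
    (hπ1 : ∀ n, dB1 n ∘ₗ π1 n = π1 (n + 1) ∘ₗ d11 n)
    (hι1 : ∀ n, d11 n ∘ₗ ι1 n = ι1 (n + 1) ∘ₗ dB1 n)
    (hπι1 : ∀ n, π1 n ∘ₗ ι1 n = LinearMap.id)
    (hh1 : ∀ n, ι1 (n + 1) ∘ₗ π1 (n + 1) - LinearMap.id =
      d11 n ∘ₗ h1 n + h1 (n + 1) ∘ₗ d11 (n + 1))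
    (hs11 : ∀ n, h1 n ∘ₗ ι1 (n + 1) = 0) (hs12 : ∀ n, π1 n ∘ₗ h1 n = 0)
    (hs13 : ∀ n, h1 n ∘ₗ h1 (n + 1) = 0)
    -- the assembled complexes and maps
    (D : ∀ n : ℤ, (A₀ n × A₁ n) →ₗ[R] (A₀ (n + 1) × A₁ (n + 1)))
    (hD : ∀ n, D n = LinearMap.prod
      (d00 n ∘ₗ LinearMap.fst R (A₀ n) (A₁ n))
      (d10 n ∘ₗ LinearMap.fst R (A₀ n) (A₁ n) + d11 n ∘ₗ LinearMap.snd R (A₀ n) (A₁ n)))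
    (DB : ∀ n : ℤ, (B₀ n × B₁ n) →ₗ[R] (B₀ (n + 1) × B₁ (n + 1)))
    (hDB : ∀ n, DB n = LinearMap.prod
      (dB0 n ∘ₗ LinearMap.fst R (B₀ n) (B₁ n))
      ((π1 (n + 1) ∘ₗ d10 n ∘ₗ ι0 n) ∘ₗ LinearMap.fst R (B₀ n) (B₁ n) +
        dB1 n ∘ₗ LinearMap.snd R (B₀ n) (B₁ n)))
    -- `Pr n` is the assembled projection in degree `n + 1`
    (Pr : ∀ n : ℤ, (A₀ (n + 1) × A₁ (n + 1)) →ₗ[R] (B₀ (n + 1) × B₁ (n + 1)))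
    (hPr : ∀ n, Pr n = LinearMap.prod
      (π0 (n + 1) ∘ₗ LinearMap.fst R (A₀ (n + 1)) (A₁ (n + 1)))
      ((π1 (n + 1) ∘ₗ d10 n ∘ₗ h0 n) ∘ₗ LinearMap.fst R (A₀ (n + 1)) (A₁ (n + 1)) +
        π1 (n + 1) ∘ₗ LinearMap.snd R (A₀ (n + 1)) (A₁ (n + 1))))
    (J : ∀ n : ℤ, (B₀ n × B₁ n) →ₗ[R] (A₀ n × A₁ n))
    (hJ : ∀ n, J n = LinearMap.prod
      (ι0 n ∘ₗ LinearMap.fst R (B₀ n) (B₁ n))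
      ((h1 n ∘ₗ d10 n ∘ₗ ι0 n) ∘ₗ LinearMap.fst R (B₀ n) (B₁ n) +
        ι1 n ∘ₗ LinearMap.snd R (B₀ n) (B₁ n)))
    (H : ∀ n : ℤ, (A₀ (n + 1) × A₁ (n + 1)) →ₗ[R] (A₀ n × A₁ n))
    (hH : ∀ n, H n = LinearMap.prod
      (h0 n ∘ₗ LinearMap.fst R (A₀ (n + 1)) (A₁ (n + 1)))
      ((h1 n ∘ₗ d10 n ∘ₗ h0 n) ∘ₗ LinearMap.fst R (A₀ (n + 1)) (A₁ (n + 1)) +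
        h1 n ∘ₗ LinearMap.snd R (A₀ (n + 1)) (A₁ (n + 1)))) :
    -- `d̄ ∘ d̄ = 0` and `(π, ι, h)` is a strong deformation retract with side conditions
    (∀ n, DB (n + 1) ∘ₗ DB n = 0) ∧
    (∀ n, DB (n + 1) ∘ₗ Pr n = Pr (n + 1) ∘ₗ D (n + 1)) ∧
    (∀ n, D n ∘ₗ J n = J (n + 1) ∘ₗ DB n) ∧
    (∀ n, Pr n ∘ₗ J (n + 1) = LinearMap.id) ∧
    (∀ n, J (n + 1) ∘ₗ Pr n - LinearMap.id = D n ∘ₗ H n + H (n + 1) ∘ₗ D (n + 1)) ∧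
    (∀ n, H n ∘ₗ J (n + 1) = 0) ∧
    (∀ n, Pr n ∘ₗ H (n + 1) = 0) ∧
    (∀ n, H n ∘ₗ H (n + 1) = 0) := by
  have e10 (n x) : d11 (n + 1) (d10 n x) = -d10 (n + 1) (d00 n x) :=
    eq_neg_of_add_eq_zero_right (LinearMap.congr_fun (hd10 n) x)
  have edB0 (n x) : dB0 (n + 1) (dB0 n x) = 0 := LinearMap.congr_fun (hdB0 n) x
  have edB1 (n x) : dB1 (n + 1) (dB1 n x) = 0 := LinearMap.congr_fun (hdB1 n) x
  have eπ0 (n x) : dB0 n (π0 n x) = π0 (n + 1) (d00 n x) := LinearMap.congr_fun (hπ0 n) x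
  have eπ1 (n x) : dB1 n (π1 n x) = π1 (n + 1) (d11 n x) := LinearMap.congr_fun (hπ1 n) x
  have eι0 (n x) : d00 n (ι0 n x) = ι0 (n + 1) (dB0 n x) := LinearMap.congr_fun (hι0 n) x
  have eι1 (n x) : d11 n (ι1 n x) = ι1 (n + 1) (dB1 n x) := LinearMap.congr_fun (hι1 n) x
  have eπι0 (n x) : π0 n (ι0 n x) = x := LinearMap.congr_fun (hπι0 n) x
  have eπι1 (n x) : π1 n (ι1 n x) = x := LinearMap.congr_fun (hπι1 n) x
  have eh0 (n x) : d00 n (h0 n x) =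
      ι0 (n + 1) (π0 (n + 1) x) - x - h0 (n + 1) (d00 (n + 1) x) :=
    eq_sub_of_add_eq (LinearMap.congr_fun (hh0 n) x).symm
  have eh1 (n x) : d11 n (h1 n x) =
      ι1 (n + 1) (π1 (n + 1) x) - x - h1 (n + 1) (d11 (n + 1) x) :=
    eq_sub_of_add_eq (LinearMap.congr_fun (hh1 n) x).symm
  have hι00 (n x) : h0 n (ι0 (n + 1) x) = 0 := LinearMap.congr_fun (hs01 n) x
  have hι11 (n x) : h1 n (ι1 (n + 1) x) = 0 := LinearMap.congr_fun (hs11 n) x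
  have πh0 (n x) : π0 n (h0 n x) = 0 := LinearMap.congr_fun (hs02 n) x
  have πh1 (n x) : π1 n (h1 n x) = 0 := LinearMap.congr_fun (hs12 n) x
  have hh00 (n x) : h0 n (h0 (n + 1) x) = 0 := LinearMap.congr_fun (hs03 n) x
  have hh11 (n x) : h1 n (h1 (n + 1) x) = 0 := LinearMap.congr_fun (hs13 n) x
  refine ⟨?_, ?_, ?_, ?_, ?_, ?_, ?_, ?_⟩ <;> refine fun n => LinearMap.ext fun x => ?_ <;>
    refine Prod.ext ?_ ?_ <;>
    simp only [hD, hDB, hPr, hJ, hH, LinearMap.comp_apply, LinearMap.prod_apply,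
      Function.prod_apply, LinearMap.add_apply, LinearMap.sub_apply, LinearMap.id_apply,
      LinearMap.zero_apply, LinearMap.fst_apply, LinearMap.snd_apply, Prod.fst_add, Prod.snd_add,
      Prod.fst_sub, Prod.snd_sub, Prod.fst_zero, Prod.snd_zero, map_add, map_sub, map_neg, map_zero,
      e10, edB0, edB1, eπ0, eπ1, eι0, eι1, eπι0, eπι1, eh0, eh1, hι00, hι11, πh0, πh1,
      hh00, hh11] <;>
    abel
end

section
/- (Homological Perturbation Lemma.) Let A be a cochain complex of R-modules with a splitting over a finite poset P, with components d_{q,p} of the differential vanishing unless p ≤ q. Suppose that for each p ∈ P there is a strong deformation retract (π_p, ι_p, h_p), satisfying the side conditions, of (A_p, d_{p,p}) onto a complex (Ā_p, d̄_p). Then there is a strong deformation retract (π, ι, h), satisfying the side conditions, of A onto the complex Ā = ⨁_{p∈P} Ā_p whose differential d̄ has (p,p)-component d̄_p and, for p < q, (q,p)-component Σ over chains p = p₁ < p₂ < ⋯ < p_k = q of π_{p_k} ∘ d_{p_k,p_{k−1}} ∘ h_{p_{k−1}} ∘ ⋯ ∘ d_{p_3,p_2} ∘ h_{p_2} ∘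 d_{p_2,p_1} ∘ ι_{p_1} (and all other components zero). The retract maps are given in components by π_{p,p} = π_p, ι_{p,p} = ι_p, h_{p,p} = h_p, and for p < q: π_{q,p} is the analogous sum over chains with the initial ι_{p_1} replaced by h_{p_1}; ι_{q,p} is the analogous sum with the final π_{p_k} replaced by h_{p_k}; and h_{q,p} is the analogous sum with both the initial ι_{p_1} replaced by h_{p_1} and the final π_{p_k} replaced by h_{p_k}. -/
open scoped Classical

/-- The composite `d ∘ h ∘ d ∘ ⋯ ∘ h ∘ d` of component differentials `d` and homotopies `h`
along a tuple `c` of `k + 2` points of the poset `P`: it is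
`d_{c(k+1), c(k)} ∘ h_{c(k)} ∘ ⋯ ∘ h_{c(1)} ∘ d_{c(1), c(0)}`, mapping degree `n` to
degree `n + 1`. -/
noncomputable def chainComp {R : Type} [CommRing R] {P : Type}
    (A : P → ℤ → Type) [∀ p n, AddCommGroup (A p n)] [∀ p n, Module R (A p n)]
    (d : ∀ q p : P, ∀ n : ℤ, A p n →ₗ[R] A q (n + 1))
    (h : ∀ p : P, ∀ n : ℤ, A p (n + 1) →ₗ[R] A p n) :
    (k : ℕ) → (c : Fin (k + 2) → P) → (n : ℤ) →
      (A (c 0) n →ₗ[R] A (c (Fin.last (k + 1))) (n + 1))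
  | 0, c, n => d (c (Fin.last 1)) (c 0) n
  | (k + 1), c, n =>
      d (c (Fin.last (k + 2))) (c (Fin.castSucc (Fin.last (k + 1)))) n ∘ₗ
        h (c (Fin.castSucc (Fin.last (k + 1)))) n ∘ₗ
          chainComp A d h k (c ∘ Fin.castSucc) n

section GeometricSum

theorem LinearMap.comp_finsetSum {R M N Q α : Type*} [CommRing R] [AddCommGroup M] [Module R M]
    [AddCommGroup N] [Module R N] [AddCommGroup Q] [Module R Q] (g : N →ₗ[R] Q) (s : Finset α)
    (f : α → M →ₗ[R] N) : g ∘ₗ (∑ i ∈ s, f i) = ∑ i ∈ s, g ∘ₗ f i := by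
  ext x
  simp [LinearMap.sum_apply]

theorem LinearMap.finsetSum_comp {R M N Q α : Type*} [CommRing R] [AddCommGroup M] [Module R M]
    [AddCommGroup N] [Module R N] [AddCommGroup Q] [Module R Q] (g : M →ₗ[R] N) (s : Finset α)
    (f : α → N →ₗ[R] Q) : (∑ i ∈ s, f i) ∘ₗ g = ∑ i ∈ s, f i ∘ₗ g := by
  ext x
  simp [LinearMap.sum_apply]

variable {R M N : Type*} [CommRing R] [AddCommGroup M] [Module R M] [AddCommGroup N] [Module R N]

/-- The partial sum `∑_{k < m} (δ ∘ h)^k ∘ δ` of the perturbation series. -/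
def perturbationSum (δ : M →ₗ[R] N) (h : N →ₗ[R] M) (m : ℕ) : M →ₗ[R] N :=
  ∑ k ∈ Finset.range m, ((δ ∘ₗ h) ^ k) ∘ₗ δ

theorem perturbationSum_apply_left {δ : M →ₗ[R] N} {h : N →ₗ[R] M} {m : ℕ}
    (hm : ((δ ∘ₗ h) ^ m) ∘ₗ δ = 0) (x : M) :
    perturbationSum δ h m x = δ x + δ (h (perturbationSum δ h m x)) := by
  have key : perturbationSum δ h (m + 1) = δ + δ ∘ₗ h ∘ₗ perturbationSum δ h m := by
    simp only [perturbationSum, Finset.sum_range_succ' _ m, LinearMap.comp_finsetSum, pow_succ']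
    rw [add_comm]
    rfl
  have last : perturbationSum δ h (m + 1) = perturbationSum δ h m := by
    simp only [perturbationSum, Finset.sum_range_succ, hm, add_zero]
  exact congr($(last.symm.trans key) x)

theorem perturbationSum_apply_right {δ : M →ₗ[R] N} {h : N →ₗ[R] M} {m : ℕ}
    (hm : ((δ ∘ₗ h) ^ m) ∘ₗ δ = 0) (x : M) :
    perturbationSum δ h m x = δ x + perturbationSum δ h m (h (δ x)) := by
  have key : perturbationSum δ h (m + 1) = δ + perturbationSum δ h m ∘ₗ h ∘ₗ δ := by
    simp only [perturbationSum, Finset.sum_range_succ' _ m, LinearMap.finsetSum_comp, pow_succ]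
    rw [add_comm]
    rfl
  have last : perturbationSum δ h (m + 1) = perturbationSum δ h m := by
    simp only [perturbationSum, Finset.sum_range_succ, hm, add_zero]
  exact congr($(last.symm.trans key) x)

end GeometricSum

section ChainSum

/-- The total map assembled from diagonal components. -/
abbrev diagMap {R : Type} [CommRing R] {P : Type} {M N : P → Type}
    [∀ p, AddCommGroup (M p)] [∀ p, Module R (M p)]
    [∀ p, AddCommGroup (N p)] [∀ p, Module R (N p)] (f : ∀ p, M p →ₗ[R] N p) :
    (∀ p, M p) →ₗ[R] (∀ p, N p) :=
  LinearMap.pi fun q => f q ∘ₗ LinearMap.proj q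

theorem diagMap_comp_single {R : Type} [CommRing R] {P : Type} [DecidableEq P] {M N : P → Type}
    [∀ p, AddCommGroup (M p)] [∀ p, Module R (M p)]
    [∀ p, AddCommGroup (N p)] [∀ p, Module R (N p)] (f : ∀ p, M p →ₗ[R] N p) (p : P) :
    diagMap f ∘ₗ LinearMap.single R M p = LinearMap.single R N p ∘ₗ f p := by
  ext x q
  by_cases hq : q = p
  · subst hq; simp
  · simp [hq]

theorem strictMono_iff_castSucc {P : Type} [PartialOrder P] {k : ℕ} (c : Fin (k + 3) → P) :
    StrictMono c ↔ StrictMono (c ∘ Fin.castSucc) ∧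
      (c ∘ Fin.castSucc) (Fin.last (k + 1)) < c (Fin.last (k + 2)) := by
  simp only [Fin.strictMono_iff_lt_succ]
  rw [Fin.forall_fin_succ']
  rfl

variable {R : Type} [CommRing R] {P : Type} [Fintype P] [PartialOrder P] [DecidableEq P]
  {A : P → ℤ → Type} [∀ p n, AddCommGroup (A p n)] [∀ p n, Module R (A p n)]

/-- The strictly triangular part of the total differential. -/
noncomputable def strictPart (d : ∀ q p : P, ∀ n : ℤ, A p n →ₗ[R] A q (n + 1)) (n : ℤ) :
    (∀ p, A p n) →ₗ[R] (∀ p, A p (n + 1)) :=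
  ∑ q : P, ∑ p : P, if p < q then
    LinearMap.single R (fun q => A q (n + 1)) q ∘ₗ d q p n ∘ₗ LinearMap.proj p else 0

/-- The contribution of the tuple `c` to the `k`-th term of the perturbation series. -/
noncomputable def chainTerm (d : ∀ q p : P, ∀ n : ℤ, A p n →ₗ[R] A q (n + 1))
    (h : ∀ p : P, ∀ n : ℤ, A p (n + 1) →ₗ[R] A p n) (k : ℕ) (c : Fin (k + 2) → P) (n : ℤ) :
    (∀ p, A p n) →ₗ[R] (∀ p, A p (n + 1)) :=
  if StrictMono c then
    LinearMap.single R (fun q => A q (n + 1)) (c (Fin.last (k + 1))) ∘ₗ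
      chainComp A d h k c n ∘ₗ LinearMap.proj (c 0)
  else 0

theorem chainTerm_succ (d : ∀ q p : P, ∀ n : ℤ, A p n →ₗ[R] A q (n + 1))
    (h : ∀ p : P, ∀ n : ℤ, A p (n + 1) →ₗ[R] A p n) (k : ℕ) (c : Fin (k + 3) → P) (n : ℤ) :
    chainTerm d h (k + 1) c n =
      (∑ p : P, if p < c (Fin.last (k + 2)) then
        LinearMap.single R (fun q => A q (n + 1)) (c (Fin.last (k + 2))) ∘ₗ
          d (c (Fin.last (k + 2))) p n ∘ₗ LinearMap.proj p else 0) ∘ₗ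
        diagMap (fun p => h p n) ∘ₗ chainTerm d h k (c ∘ Fin.castSucc) n := by
  unfold chainTerm
  simp only [strictMono_iff_castSucc c]
  by_cases h1 : StrictMono (c ∘ Fin.castSucc)
  · simp only [h1, true_and, if_true]
    rw [← LinearMap.comp_assoc _ _ (diagMap _), diagMap_comp_single, LinearMap.finsetSum_comp,
      Finset.sum_eq_single ((c ∘ Fin.castSucc) (Fin.last (k + 1)))]
    · split_ifs with h2
      · ext x
        simp [chainComp]
        rfl
      · simp
    · intro p _ hp
      simp only [Function.comp_apply] at hp
      split_ifs with h2
      · ext x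
        simp [hp]
      · simp
    · simp
  · simp [h1]

theorem sum_chainTerm (d : ∀ q p : P, ∀ n : ℤ, A p n →ₗ[R] A q (n + 1))
    (h : ∀ p : P, ∀ n : ℤ, A p (n + 1) →ₗ[R] A p n) (n : ℤ) (k : ℕ) :
    ∑ c : Fin (k + 2) → P, chainTerm d h k c n =
      ((strictPart d n ∘ₗ diagMap (fun p => h p n)) ^ k) ∘ₗ strictPart d n := by
  induction k with
  | zero =>
    rw [pow_zero, Module.End.one_eq_id, LinearMap.id_comp, strictPart, Finset.sum_comm,
      ← Fintype.sum_prod_type', ← (finTwoArrowEquiv P).sum_comp]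
    refine Finset.sum_congr rfl fun c _ => ?_
    have : StrictMono c ↔ c 0 < c 1 := by
      rw [Fin.strictMono_iff_lt_succ]
      simp
    exact if_congr this rfl rfl
  | succ k ih =>
    rw [pow_succ', Module.End.mul_eq_comp, LinearMap.comp_assoc, ← ih]
    rw [← (Fin.snocEquiv (fun _ : Fin (k + 3) => P)).sum_comp, Fintype.sum_prod_type]
    simp only [chainTerm_succ]
    rw [strictPart, LinearMap.finsetSum_comp, LinearMap.finsetSum_comp]
    refine Finset.sum_congr rfl fun q _ => ?_
    rw [LinearMap.comp_finsetSum]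
    refine Finset.sum_congr rfl fun c _ => ?_
    have h1 : (Fin.snocEquiv (fun _ : Fin (k + 3) => P)) (q, c) ∘ Fin.castSucc = c := by
      ext i
      simp [Fin.snocEquiv]
    have h2 : (Fin.snocEquiv (fun _ : Fin (k + 3) => P)) (q, c) (Fin.last (k + 2)) = q := by
      simp [Fin.snocEquiv]
    rw [h1, h2]
    rfl

theorem strictPart_nilpotent (d : ∀ q p : P, ∀ n : ℤ, A p n →ₗ[R] A q (n + 1))
    (h : ∀ p : P, ∀ n : ℤ, A p (n + 1) →ₗ[R] A p n) (n : ℤ) :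
    ((strictPart d n ∘ₗ diagMap (fun p => h p n)) ^ Fintype.card P) ∘ₗ strictPart d n = 0 := by
  rw [← sum_chainTerm]
  refine Finset.sum_eq_zero fun c _ => if_neg fun hc => ?_
  have := Fintype.card_le_of_injective c hc.injective
  simp at this

theorem sum_chainComp {M N : P → Type} [∀ p, AddCommGroup (M p)] [∀ p, Module R (M p)]
    [∀ p, AddCommGroup (N p)] [∀ p, Module R (N p)]
    (d : ∀ q p : P, ∀ n : ℤ, A p n →ₗ[R] A q (n + 1))
    (h : ∀ p : P, ∀ n : ℤ, A p (n + 1) →ₗ[R] A p n) (n : ℤ) (m : ℕ)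
    (f : ∀ p, A p (n + 1) →ₗ[R] N p) (g : ∀ p, M p →ₗ[R] A p n) :
    ∑ k ∈ Finset.range m, ∑ c : Fin (k + 2) → P,
        (if StrictMono c then
          LinearMap.single R N (c (Fin.last (k + 1))) ∘ₗ
            f (c (Fin.last (k + 1))) ∘ₗ chainComp A d h k c n ∘ₗ
              g (c 0) ∘ₗ LinearMap.proj (c 0)
        else 0) =
      diagMap f ∘ₗ perturbationSum (strictPart d n) (diagMap fun p => h p n) m ∘ₗ diagMap g := by
  rw [perturbationSum, LinearMap.finsetSum_comp, LinearMap.comp_finsetSum]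
  refine Finset.sum_congr rfl fun k _ => ?_
  rw [← sum_chainTerm, LinearMap.finsetSum_comp, LinearMap.comp_finsetSum]
  refine Finset.sum_congr rfl fun c _ => ?_
  unfold chainTerm
  split_ifs
  · rw [← LinearMap.comp_assoc, ← diagMap_comp_single]
    rfl
  · simp

theorem totalDifferential_eq (d : ∀ q p : P, ∀ n : ℤ, A p n →ₗ[R] A q (n + 1))
    (hdle : ∀ q p : P, ¬ p ≤ q → ∀ n, d q p n = 0) (n : ℤ) :
    LinearMap.pi (fun q => ∑ p : P, d q p n ∘ₗ LinearMap.proj p) =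
      diagMap (fun p => d p p n) + strictPart d n := by
  refine LinearMap.ext fun x => funext fun q => ?_
  have h1 : strictPart d n x q = ∑ p : P, if p < q then d q p n (x p) else 0 := by
    simp only [strictPart, LinearMap.sum_apply, Finset.sum_apply]
    rw [Finset.sum_eq_single q]
    · refine Finset.sum_congr rfl fun p _ => ?_
      split_ifs <;> simp
    · intro r _ hr
      refine Finset.sum_eq_zero fun p _ => ?_
      split_ifs <;> simp [hr.symm]
    · simp
  have h2 : d q q n (x q) = ∑ p : P, if p = q then d q p n (x p) else 0 := by
    simp
  simp only [LinearMap.pi_apply, LinearMap.sum_apply, LinearMap.comp_apply, LinearMap.proj_apply,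
    LinearMap.add_apply, Pi.add_apply, h1]
  rw [h2, ← Finset.sum_add_distrib]
  refine Finset.sum_congr rfl fun p _ => ?_
  rcases eq_or_ne p q with rfl | hpq
  · simp
  · by_cases hlt : p < q
    · simp [hlt, hpq]
    · have : ¬ p ≤ q := fun hle => hlt (lt_of_le_of_ne hle hpq)
      simp [hlt, hpq, hdle q p this]

end ChainSum

section Perturbation

variable {R : Type*} [CommRing R] {M N : ℤ → Type*}
  [∀ n, AddCommGroup (M n)] [∀ n, Module R (M n)] [∀ n, AddCommGroup (N n)] [∀ n, Module R (N n)]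

/-- If `T` is the sum of the perturbation series of `δ` along `h`, where `d + δ` is a perturbed
differential, then `T ι π T + T d + d T = 0`. -/
theorem perturbation_key {d δ T : ∀ n, M n →ₗ[R] M (n + 1)} {h : ∀ n, M (n + 1) →ₗ[R] M n}
    {p : ∀ n, M n →ₗ[R] N n} {i : ∀ n, N n →ₗ[R] M n}
    (hδ : ∀ n x, d (n + 1) (δ n x) + δ (n + 1) (d n x) + δ (n + 1) (δ n x) = 0)
    (hTl : ∀ n x, T n x = δ n x + δ n (h n (T n x)))
    (hTr : ∀ n x, T n x = δ n x + T n (h n (δ n x)))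
    (hh : ∀ n x, i (n + 1) (p (n + 1) x) - x = d n (h n x) + h (n + 1) (d (n + 1) x))
    (n : ℤ) (x : M n) :
    T (n + 1) (i (n + 1) (p (n + 1) (T n x))) + T (n + 1) (d n x) + d (n + 1) (T n x) = 0 := by
  obtain ⟨v, hv⟩ : ∃ v, v = x + h n (T n x) := ⟨_, rfl⟩
  have e0 : T n x = δ n v := by rw [hv, map_add, ← hTl]
  have e1 := congrArg (T (n + 1)) (hh n (T n x))
  have e2 := congrArg (fun y => T (n + 1) (d n y)) hv
  have e3 := hTr (n + 1) (d n v)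
  have e4 := hTr (n + 1) (δ n v)
  have e5 := hδ n v
  have e6 := congrArg (fun y => T (n + 1) (h (n + 1) y)) e5
  simp only [map_add, map_sub, map_zero] at e1 e2 e6
  rw [e0] at *
  linear_combination (norm := module) e1 - e2 + e3 + e4 + e5 + e6

/-- The perturbation lemma for graded modules, given the sum `T` of the perturbation series. -/
theorem perturbation_retract {d δ T : ∀ n, M n →ₗ[R] M (n + 1)} {h : ∀ n, M (n + 1) →ₗ[R] M n}
    {e : ∀ n, N n →ₗ[R] N (n + 1)} {p : ∀ n, M n →ₗ[R] N n} {i : ∀ n, N n →ₗ[R] M n}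
    (hδ : ∀ n x, d (n + 1) (δ n x) + δ (n + 1) (d n x) + δ (n + 1) (δ n x) = 0)
    (hTl : ∀ n x, T n x = δ n x + δ n (h n (T n x)))
    (hTr : ∀ n x, T n x = δ n x + T n (h n (δ n x)))
    (he : ∀ n x, e (n + 1) (e n x) = 0)
    (hp : ∀ n x, e n (p n x) = p (n + 1) (d n x))
    (hi : ∀ n x, d n (i n x) = i (n + 1) (e n x))
    (hpi : ∀ n x, p n (i n x) = x)
    (hh : ∀ n x, i (n + 1) (p (n + 1) x) - x = d n (h n x) + h (n + 1) (d (n + 1) x))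
    (hhi : ∀ n x, h n (i (n + 1) x) = 0)
    (hph : ∀ n x, p n (h n x) = 0)
    (hhh : ∀ n x, h n (h (n + 1) x) = 0)
    {D : ∀ n, M n →ₗ[R] M (n + 1)} (hD : ∀ n, D n = d n + δ n)
    {E : ∀ n, N n →ₗ[R] N (n + 1)} (hE : ∀ n, E n = e n + p (n + 1) ∘ₗ T n ∘ₗ i n)
    {Q : ∀ n, M (n + 1) →ₗ[R] N (n + 1)}
    (hQ : ∀ n, Q n = p (n + 1) + p (n + 1) ∘ₗ T n ∘ₗ h n)
    {J : ∀ n, N n →ₗ[R] M n} (hJ : ∀ n, J n = i n + h n ∘ₗ T n ∘ₗ i n)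
    {H : ∀ n, M (n + 1) →ₗ[R] M n} (hH : ∀ n, H n = h n + h n ∘ₗ T n ∘ₗ h n) :
    (∀ n, E (n + 1) ∘ₗ E n = 0) ∧
    (∀ n, E (n + 1) ∘ₗ Q n = Q (n + 1) ∘ₗ D (n + 1)) ∧
    (∀ n, D n ∘ₗ J n = J (n + 1) ∘ₗ E n) ∧
    (∀ n, Q n ∘ₗ J (n + 1) = LinearMap.id) ∧
    (∀ n, J (n + 1) ∘ₗ Q n - LinearMap.id = D n ∘ₗ H n + H (n + 1) ∘ₗ D (n + 1)) ∧
    (∀ n, H n ∘ₗ J (n + 1) = 0) ∧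
    (∀ n, Q n ∘ₗ H (n + 1) = 0) ∧
    (∀ n, H n ∘ₗ H (n + 1) = 0) := by
  have key := perturbation_key hδ hTl hTr hh
  refine ⟨fun n => LinearMap.ext fun x => ?_, fun n => LinearMap.ext fun x => ?_,
    fun n => LinearMap.ext fun x => ?_, fun n => LinearMap.ext fun x => ?_,
    fun n => LinearMap.ext fun x => ?_, fun n => LinearMap.ext fun x => ?_,
    fun n => LinearMap.ext fun x => ?_, fun n => LinearMap.ext fun x => ?_⟩
  · have k := congrArg (p (n + 1 + 1)) (key n (i n x))
    simp only [map_add, map_zero, hi] at k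
    simp only [hE, LinearMap.comp_apply, LinearMap.add_apply, map_add, he, hp,
      LinearMap.zero_apply]
    linear_combination (norm := module) k
  · have k := congrArg (p (n + 1 + 1)) (key n (h n x))
    have k1 := congrArg (fun y => p (n + 1 + 1) (T (n + 1) y)) (hh n x)
    have k2 := congrArg (p (n + 1 + 1)) (hTr (n + 1) x)
    simp only [map_add, map_sub, map_zero] at k k1 k2
    simp only [hE, hQ, hD, LinearMap.comp_apply, LinearMap.add_apply, map_add, hp]
    linear_combination (norm := module) k + k1 + k2
  · have k := congrArg (h (n + 1)) (key n (i n x))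
    have k1 := hh n (T n (i n x))
    have k2 := hTl n (i n x)
    simp only [map_add, map_zero, hi] at k
    simp only [hE, hJ, hD, LinearMap.comp_apply, LinearMap.add_apply, map_add, hi]
    linear_combination (norm := module) -k - k1 - k2
  · simp [hQ, hJ, hpi, hhi, hph, hhh]
  · have k := congrArg (h (n + 1)) (key n (h n x))
    have k0 := hh n x
    have k1 := hh n (T n (h n x))
    have k2 := hTl n (h n x)
    have k3 := congrArg (fun y => h (n + 1) (T (n + 1) y)) (hh n x)
    have k4 := congrArg (h (n + 1)) (hTr (n + 1) x)
    simp only [map_add, map_sub, map_zero] at k k3 k4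
    simp only [hQ, hJ, hH, hD, LinearMap.comp_apply, LinearMap.add_apply, LinearMap.sub_apply,
      LinearMap.id_apply, map_add]
    linear_combination (norm := module) k + k0 + k1 + k2 + k3 + k4
  · simp [hH, hJ, hhi, hhh]
  · simp [hQ, hH, hph, hhh]
  · simp [hH, hhh]

end Perturbation

/-- **Homological Perturbation Lemma.** Let `A` be a cochain complex split over a finite poset
`P`, with differential components `d q p : A_p → A_q` vanishing unless `p ≤ q`, and suppose each
diagonal complex `(A_p, d_{p,p})` strongly deformation retracts (with side conditions) onto
`(Ā_p, d̄_p)` (here written `(B p, dB p)`).  Then `Ā = ⨁_p Ā_p`, with differential whose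
`(p,p)`-component is `d̄_p` and whose `(q,p)`-component for `p < q` is the sum over strict
chains `p = p₁ < ⋯ < p_k = q` of `π_q ∘ d ∘ h ∘ ⋯ ∘ h ∘ d ∘ ι_p` (all other components zero),
is a complex, and the maps `π, ι, h` with diagonal components `π_p, ι_p, h_p` and off-diagonal
components the analogous chain sums (with `ι_p` resp. `π_q` replaced by `h_p` resp. `h_q`)
form a strong deformation retract of `A` onto `Ā` satisfying the side conditions.
Here everything is assembled into global maps on the direct sums `∀ p, A p n`, `∀ p, B p n`;
the chain sums are the sums over all strictly monotone tuples `c` in `P`, routed through the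
projections and inclusions of the direct sum (which is exactly the componentwise chain-sum
formula), and `Pr n` denotes the assembled retraction `π` in degree `n + 1`. -/
theorem stmt15 {R : Type} [CommRing R] {P : Type} [Fintype P] [PartialOrder P] [DecidableEq P]
    (A B : P → ℤ → Type)
    [∀ p n, AddCommGroup (A p n)] [∀ p n, Module R (A p n)]
    [∀ p n, AddCommGroup (B p n)] [∀ p n, Module R (B p n)]
    (d : ∀ q p : P, ∀ n : ℤ, A p n →ₗ[R] A q (n + 1))
    (hdle : ∀ q p : P, ¬ p ≤ q → ∀ n, d q p n = 0)
    (hd2 : ∀ q p : P, ∀ n : ℤ, ∑ r : P, d q r (n + 1) ∘ₗ d r p n = 0)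
    (dB : ∀ p : P, ∀ n : ℤ, B p n →ₗ[R] B p (n + 1))
    (hdB2 : ∀ p n, dB p (n + 1) ∘ₗ dB p n = 0)
    (π : ∀ p : P, ∀ n : ℤ, A p n →ₗ[R] B p n)
    (ι : ∀ p : P, ∀ n : ℤ, B p n →ₗ[R] A p n)
    (h : ∀ p : P, ∀ n : ℤ, A p (n + 1) →ₗ[R] A p n)
    -- for each `p`, `(π_p, ι_p, h_p)` is a strong deformation retract of `(A_p, d_{p,p})`
    -- onto `(B_p, d̄_p)` satisfying the side conditions
    (hπ : ∀ p n, dB p n ∘ₗ π p n = π p (n + 1) ∘ₗ d p p n)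
    (hι : ∀ p n, d p p n ∘ₗ ι p n = ι p (n + 1) ∘ₗ dB p n)
    (hπι : ∀ p n, π p n ∘ₗ ι p n = LinearMap.id)
    (hhtpy : ∀ p n, ι p (n + 1) ∘ₗ π p (n + 1) - LinearMap.id =
      d p p n ∘ₗ h p n + h p (n + 1) ∘ₗ d p p (n + 1))
    (hside1 : ∀ p n, h p n ∘ₗ ι p (n + 1) = 0)
    (hside2 : ∀ p n, π p n ∘ₗ h p n = 0)
    (hside3 : ∀ p n, h p n ∘ₗ h p (n + 1) = 0)
    -- the assembled total complexes and maps
    (D : ∀ n : ℤ, (∀ p, A p n) →ₗ[R] (∀ p, A p (n + 1)))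
    (hD : ∀ n, D n = LinearMap.pi (fun q => ∑ p : P, d q p n ∘ₗ LinearMap.proj p))
    (DB : ∀ n : ℤ, (∀ p, B p n) →ₗ[R] (∀ p, B p (n + 1)))
    (hDB : ∀ n, DB n = LinearMap.pi (fun q => dB q n ∘ₗ LinearMap.proj q) +
      ∑ k ∈ Finset.range (Fintype.card P), ∑ c : Fin (k + 2) → P,
        (if StrictMono c then
          LinearMap.single R (fun q => B q (n + 1)) (c (Fin.last (k + 1))) ∘ₗ
            π (c (Fin.last (k + 1))) (n + 1) ∘ₗ chainComp A d h k c n ∘ₗ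
              ι (c 0) n ∘ₗ LinearMap.proj (c 0)
        else 0))
    (Pr : ∀ n : ℤ, (∀ p, A p (n + 1)) →ₗ[R] (∀ p, B p (n + 1)))
    (hPr : ∀ n, Pr n = LinearMap.pi (fun q => π q (n + 1) ∘ₗ LinearMap.proj q) +
      ∑ k ∈ Finset.range (Fintype.card P), ∑ c : Fin (k + 2) → P,
        (if StrictMono c then
          LinearMap.single R (fun q => B q (n + 1)) (c (Fin.last (k + 1))) ∘ₗ
            π (c (Fin.last (k + 1))) (n + 1) ∘ₗ chainComp A d h k c n ∘ₗ
              h (c 0) n ∘ₗ LinearMap.proj (c 0)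
        else 0))
    (J : ∀ n : ℤ, (∀ p, B p n) →ₗ[R] (∀ p, A p n))
    (hJ : ∀ n, J n = LinearMap.pi (fun q => ι q n ∘ₗ LinearMap.proj q) +
      ∑ k ∈ Finset.range (Fintype.card P), ∑ c : Fin (k + 2) → P,
        (if StrictMono c then
          LinearMap.single R (fun q => A q n) (c (Fin.last (k + 1))) ∘ₗ
            h (c (Fin.last (k + 1))) n ∘ₗ chainComp A d h k c n ∘ₗ
              ι (c 0) n ∘ₗ LinearMap.proj (c 0)
        else 0))
    (H : ∀ n : ℤ, (∀ p, A p (n + 1)) →ₗ[R] (∀ p, A p n))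
    (hH : ∀ n, H n = LinearMap.pi (fun q => h q n ∘ₗ LinearMap.proj q) +
      ∑ k ∈ Finset.range (Fintype.card P), ∑ c : Fin (k + 2) → P,
        (if StrictMono c then
          LinearMap.single R (fun q => A q n) (c (Fin.last (k + 1))) ∘ₗ
            h (c (Fin.last (k + 1))) n ∘ₗ chainComp A d h k c n ∘ₗ
              h (c 0) n ∘ₗ LinearMap.proj (c 0)
        else 0)) :
    -- the perturbed differential squares to zero and `(π, ι, h)` is a strong deformation
    -- retract of `A` onto `Ā` satisfying the side conditions
    (∀ n, DB (n + 1) ∘ₗ DB n = 0) ∧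
    (∀ n, DB (n + 1) ∘ₗ Pr n = Pr (n + 1) ∘ₗ D (n + 1)) ∧
    (∀ n, D n ∘ₗ J n = J (n + 1) ∘ₗ DB n) ∧
    (∀ n, Pr n ∘ₗ J (n + 1) = LinearMap.id) ∧
    (∀ n, J (n + 1) ∘ₗ Pr n - LinearMap.id = D n ∘ₗ H n + H (n + 1) ∘ₗ D (n + 1)) ∧
    (∀ n, H n ∘ₗ J (n + 1) = 0) ∧
    (∀ n, Pr n ∘ₗ H (n + 1) = 0) ∧
    (∀ n, H n ∘ₗ H (n + 1) = 0) := by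
  have hd0 : ∀ n, diagMap (fun p => d p p (n + 1)) ∘ₗ diagMap (fun p => d p p n) = 0 := by
    intro n
    refine LinearMap.ext fun x => funext fun p => ?_
    have := hd2 p p n
    rw [Finset.sum_eq_single p (fun r _ hr => ?_) (by simp)] at this
    · exact congr($this (x p))
    · by_cases hpr : p ≤ r
      · rw [hdle p r fun hrp => hr (le_antisymm hrp hpr), LinearMap.zero_comp]
      · rw [hdle r p hpr, LinearMap.comp_zero]
  have hDD : ∀ n, D (n + 1) ∘ₗ D n = 0 := by
    intro n
    refine LinearMap.ext fun x => funext fun q => ?_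
    have := fun p => congr($(hd2 q p n) (x p))
    simp only [LinearMap.sum_apply, LinearMap.comp_apply, LinearMap.zero_apply] at this
    simp only [hD, LinearMap.comp_apply, LinearMap.pi_apply, LinearMap.sum_apply,
      LinearMap.proj_apply, map_sum, LinearMap.zero_apply, Pi.zero_apply]
    rw [Finset.sum_comm]
    exact Finset.sum_eq_zero fun p _ => this p
  have hD' : ∀ n, D n = diagMap (fun p => d p p n) + strictPart d n := fun n => by
    rw [hD, totalDifferential_eq d hdle]
  refine perturbation_retract (d := fun n => diagMap fun p => d p p n) (δ := strictPart d)
    (T := fun n => perturbationSum (strictPart d n) (diagMap fun p => h p n) (Fintype.card P))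
    (h := fun n => diagMap fun p => h p n) (e := fun n => diagMap fun p => dB p n)
    (p := fun n => diagMap fun p => π p n) (i := fun n => diagMap fun p => ι p n)
    ?_ (fun n => perturbationSum_apply_left (strictPart_nilpotent d h n))
    (fun n => perturbationSum_apply_right (strictPart_nilpotent d h n))
    (fun n x => funext fun p => congr($(hdB2 p n) (x p)))
    (fun n x => funext fun p => congr($(hπ p n) (x p)))
    (fun n x => funext fun p => congr($(hι p n) (x p)))
    (fun n x => funext fun p => congr($(hπι p n) (x p)))
    (fun n x => funext fun p => congr($(hhtpy p n) (x p)))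
    (fun n x => funext fun p => congr($(hside1 p n) (x p)))
    (fun n x => funext fun p => congr($(hside2 p n) (x p)))
    (fun n x => funext fun p => congr($(hside3 p n) (x p)))
    hD' (fun n => ?_) (fun n => ?_) (fun n => ?_) (fun n => ?_)
  · intro n x
    have h1 := congr($(hDD n) x)
    have h2 := congr($(hd0 n) x)
    simp only [hD', LinearMap.comp_apply, LinearMap.add_apply, map_add,
      LinearMap.zero_apply] at h1 h2
    linear_combination (norm := module) h1 - h2
  · rw [hDB, sum_chainComp d h n _ (fun p => π p (n + 1)) (fun p => ι p n)]
  · rw [hPr, sum_chainComp d h n _ (fun p => π p (n + 1)) (fun p => h p n)]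
  · rw [hJ, sum_chainComp d h n _ (fun p => h p n) (fun p => ι p n)]
  · rw [hH, sum_chainComp d h n _ (fun p => h p n) (fun p => h p n)]
end

section
/- Let R be a ring, and suppose given two short exact sequences of R-modules 0 → A → B → C → 0 and 0 → A' → B' → C' → 0 together with a map of short exact sequences from the first to the second, i.e., R-module maps f : A → A', g : B → B', h : C → C' making the evident squares commute. Assume f and h are split injections (inclusions onto direct summands, i.e., each admits an R-linear retraction). If the sequence 0 → A' → B' → C' → 0 splits, then the sequence 0 → A → B → C → 0 also splits, and g : B → B' is a split injection. -/
/-- A retraction of the left map of a short exact sequence determines a section of the right map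
which exhibits the middle term as a direct sum. -/
theorem exists_section_of_retraction {R A B C : Type*} [Ring R]
    [AddCommGroup A] [Module R A] [AddCommGroup B] [Module R B] [AddCommGroup C] [Module R C]
    {i : A →ₗ[R] B} {p : B →ₗ[R] C} (hp : Function.Surjective p) (hex : Function.Exact i p)
    {r : B →ₗ[R] A} (hr : r ∘ₗ i = LinearMap.id) :
    ∃ s : C →ₗ[R] B, p ∘ₗ s = LinearMap.id ∧ i ∘ₗ r + s ∘ₗ p = LinearMap.id := by
  obtain ⟨-, s₀, hs₀⟩ := (hex.split_tfae'.out 1 0 rfl rfl).mp ⟨hp, r, hr⟩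
  replace hr : ∀ a, r (i a) = a := LinearMap.congr_fun hr
  replace hs₀ : ∀ c, p (s₀ c) = c := LinearMap.congr_fun hs₀
  have hpi : ∀ a, p (i a) = 0 := hex.apply_apply_eq_zero
  refine ⟨s₀ - i ∘ₗ r ∘ₗ s₀, ?_, ?_⟩
  · ext c
    simp [hpi, hs₀]
  · ext b
    obtain ⟨a, ha⟩ := (hex (b - s₀ (p b))).mp (by simp [hs₀])
    obtain rfl : a = r b - r (s₀ (p b)) := by rw [← hr a, ha, map_sub]
    rw [map_sub] at ha
    simp only [LinearMap.add_apply, LinearMap.comp_apply, LinearMap.sub_apply, LinearMap.id_apply]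
    rw [add_sub_left_comm, ha, add_sub_cancel]


/-- Given a map of short exact sequences of `R`-modules in which the outer two vertical maps
are split injections, if the target short exact sequence splits then so does the source one,
and the middle vertical map is a split injection. -/
theorem stmt17 (R : Type) [Ring R]
    (A B C A' B' C' : Type)
    [AddCommGroup A] [Module R A] [AddCommGroup B] [Module R B] [AddCommGroup C] [Module R C]
    [AddCommGroup A'] [Module R A'] [AddCommGroup B'] [Module R B']
    [AddCommGroup C'] [Module R C']
    (i : A →ₗ[R] B) (p : B →ₗ[R] C) (i' : A' →ₗ[R] B') (p' : B' →ₗ[R] C')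
    -- the two rows are short exact
    (hi : Function.Injective i) (hp : Function.Surjective p)
    (hex : LinearMap.range i = LinearMap.ker p)
    (hi' : Function.Injective i') (hp' : Function.Surjective p')
    (hex' : LinearMap.range i' = LinearMap.ker p')
    -- the vertical maps form a map of short exact sequences
    (f : A →ₗ[R] A') (g : B →ₗ[R] B') (h : C →ₗ[R] C')
    (sq1 : i' ∘ₗ f = g ∘ₗ i) (sq2 : p' ∘ₗ g = h ∘ₗ p)
    -- `f` and `h` are split injections (admit `R`-linear retractions)
    (hf : ∃ rf : A' →ₗ[R] A, rf ∘ₗ f = LinearMap.id)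
    (hh : ∃ rh : C' →ₗ[R] C, rh ∘ₗ h = LinearMap.id)
    -- the bottom sequence splits
    (hsplit' : ∃ s' : C' →ₗ[R] B', p' ∘ₗ s' = LinearMap.id) :
    (∃ s : C →ₗ[R] B, p ∘ₗ s = LinearMap.id) ∧
    (∃ rg : B' →ₗ[R] B, rg ∘ₗ g = LinearMap.id) := by
  obtain ⟨rf, hrf⟩ := hf
  obtain ⟨rh, hrh⟩ := hh
  have hE : Function.Exact i p := LinearMap.exact_iff.mpr hex.symm
  have hE' : Function.Exact i' p' := LinearMap.exact_iff.mpr hex'.symm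
  obtain ⟨-, r', hr'⟩ := (hE'.split_tfae'.out 0 1 rfl rfl).mp ⟨hi', hsplit'⟩
  have hr : (rf ∘ₗ r' ∘ₗ g) ∘ₗ i = LinearMap.id := by
    rw [LinearMap.comp_assoc, LinearMap.comp_assoc, ← sq1, ← LinearMap.comp_assoc _ i' r', hr',
      LinearMap.id_comp, hrf]
  obtain ⟨s, hs, hsum⟩ := exists_section_of_retraction hp hE hr
  refine ⟨⟨s, hs⟩, i ∘ₗ rf ∘ₗ r' + s ∘ₗ rh ∘ₗ p', ?_⟩
  rw [LinearMap.add_comp, LinearMap.comp_assoc, LinearMap.comp_assoc, LinearMap.comp_assoc,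
    LinearMap.comp_assoc, sq2, ← LinearMap.comp_assoc _ h rh, hrh, LinearMap.id_comp, hsum]
end
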